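/- arXiv:2202.00629 — 7 statements merged into one kernel-verified Lean document; each statement's English description precedes it below -/
import Mathlib

section
/- Let d ≥ 1, θ ∈ ℝ^d, a ∈ ℝ^d with a ≠ 0, Σ a positive definite d×d matrix, h : (0,∞) → [0,∞) measurable, and c₁ ≥ 0, c₂ ∈ ℝ with either c₁ > 0, or c₁ = 0 and c₂ ≥ 0; assume ∫₀^∞ h(v) e^{−v c₂ − v² c₁/2} dv = 1. Set c₁' := (c₁ + aᵀΣ⁻¹a)^{1/2}, and for x ∈ ℝ^d set c₂' := (x − θ)ᵀΣ⁻¹a − c₂ and Δ := c₂'/c₁'. Then for every x ∈ ℝ^d: ∫₀^∞ φ_d(x − θ − v a; Σ) h(v) e^{−v c₂ − v² c₁/2} dv = φ_d(x − θ; Σ) · (1/(c₁' · φ(Δ))) · ∫_{−Δ}^∞ h((z + Δ)/c₁') φ(z) dz. -/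
open MeasureTheory Matrix Real

/-- The centered `d`-variate normal density `φ_d(z; Σ)` with covariance matrix `S`. -/
noncomputable def mvn (d : ℕ) (S : Matrix (Fin d) (Fin d) ℝ) (z : Fin d → ℝ) : ℝ :=
  (2 * π) ^ (-(d : ℝ) / 2) * S.det ^ (-(1 : ℝ) / 2) * Real.exp (-(z ⬝ᵥ S⁻¹ *ᵥ z) / 2)

/-- The standard normal density `φ` on `ℝ`. -/
noncomputable def stdphi (t : ℝ) : ℝ := Real.exp (-(t ^ 2) / 2) / Real.sqrt (2 * π)

theorem stdphi_pos (t : ℝ) : 0 < stdphi t := by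
  unfold stdphi
  positivity

theorem mvn_sub_smul {d : ℕ} {S : Matrix (Fin d) (Fin d) ℝ} (hS : S⁻¹.IsHermitian)
    (w a : Fin d → ℝ) (v : ℝ) :
    mvn d S (w - v • a) = mvn d S w *
      Real.exp (v * (w ⬝ᵥ S⁻¹ *ᵥ a) - v ^ 2 * (a ⬝ᵥ S⁻¹ *ᵥ a) / 2) := by
  have hsymm : a ⬝ᵥ S⁻¹ *ᵥ w = w ⬝ᵥ S⁻¹ *ᵥ a := by
    have hT : (S⁻¹)ᵀ = S⁻¹ := by simpa [conjTranspose_eq_transpose_of_trivial] using hS.eq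
    rw [dotProduct_mulVec, ← mulVec_transpose, hT, dotProduct_comm]
  unfold mvn
  rw [mul_assoc _ (Real.exp _), ← Real.exp_add]
  congr 2
  simp only [mulVec_sub, mulVec_smul, sub_dotProduct, dotProduct_sub, smul_dotProduct,
    dotProduct_smul, smul_eq_mul, hsymm]
  ring

theorem stdphi_mul_sub (c Δ v : ℝ) :
    stdphi (c * v - Δ) = stdphi Δ * Real.exp (v * (c * Δ) - v ^ 2 * c ^ 2 / 2) := by
  unfold stdphi
  rw [div_mul_eq_mul_div, ← Real.exp_add]
  congr 2
  ring

theorem integral_Ioi_comp_mul_sub {c : ℝ} (hc : 0 < c) (Δ : ℝ) (g : ℝ → ℝ) :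
    ∫ v in Set.Ioi (0 : ℝ), g (c * v - Δ) = c⁻¹ * ∫ z in Set.Ioi (-Δ), g z := by
  have hscale := integral_comp_mul_left_Ioi (fun y => g (y - Δ)) 0 hc
  rw [hscale, mul_zero, smul_eq_mul]
  have hshift := (measurePreserving_sub_right volume Δ).setIntegral_preimage_emb
    (MeasurableEquiv.subRight Δ).measurableEmbedding g (Set.Ioi (-Δ))
  simpa using congrArg (c⁻¹ * ·) hshift

/-- the model density of an MMN distribution with mixing density
`ℓ(v) = h(v) e^{−vc₂} e^{−v²c₁/2} 𝟙_{(0,∞)}(v)` equals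
`φ_d(x − θ; Σ) · (1/(c₁'φ(Δ))) · ∫_{−Δ}^∞ h((z + Δ)/c₁') φ(z) dz`, where
`c₁' = (c₁ + aᵀΣ⁻¹a)^{1/2}`, `c₂' = (x − θ)ᵀΣ⁻¹a − c₂` and `Δ = c₂'/c₁'`. -/
theorem mmn_density_general_mixing
    (d : ℕ) (hd : 1 ≤ d) (θ a : Fin d → ℝ) (ha : a ≠ 0)
    (S : Matrix (Fin d) (Fin d) ℝ) (hS : S.PosDef)
    (h : ℝ → ℝ) (hmeas : Measurable h) (hpos : ∀ v ∈ Set.Ioi (0 : ℝ), 0 ≤ h v)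
    (c₁ c₂ : ℝ) (hc : 0 < c₁ ∨ (c₁ = 0 ∧ 0 ≤ c₂))
    (hnorm : ∫ v in Set.Ioi (0 : ℝ), h v * Real.exp (-v * c₂ - v ^ 2 * c₁ / 2) = 1)
    (x : Fin d → ℝ)
    (c₁' c₂' Δ : ℝ)
    (hc₁' : c₁' = Real.sqrt (c₁ + a ⬝ᵥ S⁻¹ *ᵥ a))
    (hc₂' : c₂' = (x - θ) ⬝ᵥ S⁻¹ *ᵥ a - c₂)
    (hΔ : Δ = c₂' / c₁') :
    ∫ v in Set.Ioi (0 : ℝ), mvn d S (x - θ - v • a) * (h v * Real.exp (-v * c₂ - v ^ 2 * c₁ / 2))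
      = mvn d S (x - θ) * (1 / (c₁' * stdphi Δ)) *
          ∫ z in Set.Ioi (-Δ), h ((z + Δ) / c₁') * stdphi z := by
  have hquad : 0 < a ⬝ᵥ S⁻¹ *ᵥ a := by simpa using hS.inv.dotProduct_mulVec_pos ha
  have hc₁ : 0 ≤ c₁ := hc.elim le_of_lt fun hc => hc.1.ge
  have hc_pos : 0 < c₁' := hc₁' ▸ Real.sqrt_pos.mpr (by positivity)
  have hsq : c₁' ^ 2 = c₁ + a ⬝ᵥ S⁻¹ *ᵥ a := by
    rw [hc₁', Real.sq_sqrt (by positivity)]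
  have hmul : c₁' * Δ = c₂' := by rw [hΔ, mul_div_cancel₀ _ hc_pos.ne']
  have hΔ_ne : stdphi Δ ≠ 0 := (stdphi_pos Δ).ne'
  have hpoint (v : ℝ) :
      mvn d S (x - θ - v • a) * (h v * Real.exp (-v * c₂ - v ^ 2 * c₁ / 2)) =
        mvn d S (x - θ) / stdphi Δ *
          (h ((c₁' * v - Δ + Δ) / c₁') * stdphi (c₁' * v - Δ)) := by
    rw [sub_add_cancel, mul_div_cancel_left₀ _ hc_pos.ne', stdphi_mul_sub, hmul, hsq,
      mvn_sub_smul hS.inv.isHermitian, hc₂']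
    have hexp : Real.exp (v * ((x - θ) ⬝ᵥ S⁻¹ *ᵥ a - c₂) - v ^ 2 * (c₁ + a ⬝ᵥ S⁻¹ *ᵥ a) / 2) =
        Real.exp (v * ((x - θ) ⬝ᵥ S⁻¹ *ᵥ a) - v ^ 2 * (a ⬝ᵥ S⁻¹ *ᵥ a) / 2) *
          Real.exp (-v * c₂ - v ^ 2 * c₁ / 2) := by
      rw [← Real.exp_add]
      congr 1
      ring
    rw [hexp]
    field_simp
  simp_rw [hpoint]
  rw [integral_const_mul,
    integral_Ioi_comp_mul_sub hc_pos Δ fun z => h ((z + Δ) / c₁') * stdphi z]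
  field_simp
end

section
/- Let d ≥ 1, a ∈ ℝ^d, Σ_X and Σ_Y positive definite d×d matrices, and L₁, L₂ probability measures on ℝ. Then for every x, y ∈ ℝ^d: ∫_{ℝ^d} [∫_ℝ φ_d(x − θ − v₁ a; Σ_X) dL₁(v₁)] · [∫_ℝ φ_d(y − θ − v₂ a; Σ_Y) dL₂(v₂)] dθ = ∫_{ℝ×ℝ} φ_d(y − x − (v₂ − v₁) a; Σ_X + Σ_Y) dL₁(v₁) dL₂(v₂). That is, the Bayes predictive density under the improper uniform prior π(θ) = 1 (the minimum risk equivariant predictive density) is the MMN_d(x, a, Σ_X + Σ_Y, L₃) density, where L₃ is the law of V₂ − V₁ for independent V₁ ∼ L₁, V₂ ∼ L₂. -/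
open MeasureTheory Matrix Real

/-- The integral of the exponential of a negative definite quadratic form. -/
theorem integral_exp_neg_quadratic {d : ℕ} {P : Matrix (Fin d) (Fin d) ℝ} (hP : P.PosDef) :
    ∫ θ : Fin d → ℝ, Real.exp (-(θ ⬝ᵥ P *ᵥ θ) / 2)
      = (2 * π) ^ ((d : ℝ) / 2) * P.det ^ (-(1 : ℝ) / 2) := by
  obtain ⟨B, hB⟩ : ∃ B : Matrix (Fin d) (Fin d) ℝ, P = Bᵀ * B := by
    open scoped MatrixOrder in
    obtain ⟨B, hB⟩ := CStarAlgebra.nonneg_iff_eq_star_mul_self.mp hP.posSemidef.nonneg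
    exact ⟨B, by simpa [star_eq_conjTranspose, conjTranspose_eq_transpose_of_trivial] using hB⟩
  have hdet : P.det = B.det ^ 2 := by rw [hB, det_mul, det_transpose, sq]
  have hB0 : B.det ≠ 0 := fun h => hP.det_pos.ne' (by simp [hdet, h])
  have hcont : Continuous fun u : Fin d → ℝ => Real.exp (-(u ⬝ᵥ u) / 2) := by
    unfold dotProduct; fun_prop
  have hquad (θ : Fin d → ℝ) : θ ⬝ᵥ P *ᵥ θ = (B *ᵥ θ) ⬝ᵥ (B *ᵥ θ) := by
    rw [hB, ← mulVec_mulVec, dotProduct_mulVec, vecMul_transpose]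
  have hstd : ∫ u : Fin d → ℝ, Real.exp (-(u ⬝ᵥ u) / 2) = (2 * π) ^ ((d : ℝ) / 2) := by
    have h (u : Fin d → ℝ) : Real.exp (-(u ⬝ᵥ u) / 2)
        = ∏ i, Real.exp (-(1 / 2) * u i ^ 2) := by
      rw [← Real.exp_sum, ← Finset.mul_sum, dotProduct]
      congr 1
      simp only [sq]
      ring
    simp_rw [h]
    rw [integral_fintype_prod_volume_eq_pow (fun t : ℝ => Real.exp (-(1 / 2) * t ^ 2)),
      integral_gaussian, Fintype.card_fin, Real.sqrt_eq_rpow, ← Real.rpow_natCast,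
      ← Real.rpow_mul (by positivity)]
    congr 1 <;> ring
  have hmap := integral_map (μ := volume) (φ := toLin' B)
    (toLin' B).continuous_of_finiteDimensional.aemeasurable
    (f := fun u : Fin d → ℝ => Real.exp (-(u ⬝ᵥ u) / 2)) hcont.aestronglyMeasurable
  rw [Real.map_matrix_volume_pi_eq_smul_volume_pi hB0, integral_smul_measure, hstd] at hmap
  simp_rw [hquad]
  simp only [toLin'_apply] at hmap
  rw [← hmap, ENNReal.toReal_ofReal (abs_nonneg _), smul_eq_mul, mul_comm, hdet, abs_inv,
    ← sq_abs, ← Real.rpow_natCast, ← Real.rpow_mul (abs_nonneg _)]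
  norm_num [Real.rpow_neg_one]

theorem mvn_pos {d : ℕ} {S : Matrix (Fin d) (Fin d) ℝ} (hS : S.PosDef) (z : Fin d → ℝ) :
    0 < mvn d S z := by
  have := hS.det_pos
  unfold mvn
  positivity

theorem continuous_mvn (d : ℕ) (S : Matrix (Fin d) (Fin d) ℝ) : Continuous (mvn d S) := by
  unfold mvn
  fun_prop

theorem mvn_le_mvn_zero {d : ℕ} {S : Matrix (Fin d) (Fin d) ℝ} (hS : S.PosDef) (z : Fin d → ℝ) :
    mvn d S z ≤ mvn d S 0 := by
  have := hS.det_pos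
  have hz : 0 ≤ z ⬝ᵥ S⁻¹ *ᵥ z := by
    simpa using hS.inv.posSemidef.dotProduct_mulVec_nonneg z
  unfold mvn
  gcongr
  simpa using hz

/-- A normal density composed with a continuous map is integrable for any finite measure. -/
theorem integrable_mvn_comp {d : ℕ} {S : Matrix (Fin d) (Fin d) ℝ} (hS : S.PosDef)
    {α : Type*} [TopologicalSpace α] [SecondCountableTopology α] [MeasurableSpace α]
    [OpensMeasurableSpace α] (μ : Measure α) [IsFiniteMeasure μ] {f : α → Fin d → ℝ}
    (hf : Continuous f) : Integrable (fun v => mvn d S (f v)) μ := by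
  refine Integrable.of_bound ((continuous_mvn d S).comp hf).aestronglyMeasurable (mvn d S 0) ?_
  refine Filter.Eventually.of_forall fun v => ?_
  rw [Real.norm_of_nonneg (mvn_pos hS _).le]
  exact mvn_le_mvn_zero hS _

/-- Completing the square in a sum of two quadratic forms. -/
theorem quadratic_add_quadratic_eq {d : ℕ} {SX SY : Matrix (Fin d) (Fin d) ℝ}
    (hSX : SX.PosDef) (hSY : SY.PosDef) (η z : Fin d → ℝ) :
    let n := SY *ᵥ (SX + SY)⁻¹ *ᵥ SX *ᵥ SY⁻¹ *ᵥ z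
    η ⬝ᵥ SX⁻¹ *ᵥ η + (z + η) ⬝ᵥ SY⁻¹ *ᵥ (z + η)
      = (η + n) ⬝ᵥ (SX⁻¹ + SY⁻¹) *ᵥ (η + n) + z ⬝ᵥ (SX + SY)⁻¹ *ᵥ z := by
  intro n
  have hX : IsUnit SX.det := hSX.det_pos.ne'.isUnit
  have hY : IsUnit SY.det := hSY.det_pos.ne'.isUnit
  have hT : IsUnit (SX + SY).det := (hSX.add hSY).det_pos.ne'.isUnit
  have hfac : SX⁻¹ + SY⁻¹ = SX⁻¹ * (SX + SY) * SY⁻¹ := by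
    rw [mul_add, add_mul, nonsing_inv_mul _ hX, one_mul, mul_assoc, mul_nonsing_inv _ hY, mul_one,
      add_comm]
  have hPn : (SX⁻¹ + SY⁻¹) *ᵥ n = SY⁻¹ *ᵥ z := by
    rw [hfac]
    simp only [n, mulVec_mulVec]
    congr 1
    simp only [Matrix.mul_assoc]
    rw [nonsing_inv_mul_cancel_left _ _ hY, mul_nonsing_inv_cancel_left _ _ hT,
      nonsing_inv_mul_cancel_left _ _ hX]
  have hdiff : SY⁻¹ *ᵥ n + (SX + SY)⁻¹ *ᵥ z = SY⁻¹ *ᵥ z := by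
    simp only [n, mulVec_mulVec, ← add_mulVec]
    congr 1
    simp only [← Matrix.mul_assoc]
    rw [nonsing_inv_mul _ hY, Matrix.one_mul]
    calc _ = (SX + SY)⁻¹ * (SX + SY) * SY⁻¹ := by
          rw [Matrix.mul_add, Matrix.add_mul, Matrix.mul_assoc _ SY, mul_nonsing_inv _ hY,
            Matrix.mul_one]
      _ = _ := by rw [nonsing_inv_mul _ hT, Matrix.one_mul]
  have hsymm {M : Matrix (Fin d) (Fin d) ℝ} (hM : M.PosDef) (u w : Fin d → ℝ) :
      u ⬝ᵥ M *ᵥ w = w ⬝ᵥ M *ᵥ u := by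
    have h : Mᵀ = M := by simpa [conjTranspose_eq_transpose_of_trivial] using hM.isHermitian.eq
    rw [dotProduct_mulVec, ← mulVec_transpose, h, dotProduct_comm]
  have h1 : n ⬝ᵥ (SX⁻¹ + SY⁻¹) *ᵥ η = η ⬝ᵥ SY⁻¹ *ᵥ z := by
    rw [hsymm (hSX.inv.add hSY.inv), hPn]
  have h2 : n ⬝ᵥ SY⁻¹ *ᵥ z + z ⬝ᵥ (SX + SY)⁻¹ *ᵥ z = z ⬝ᵥ SY⁻¹ *ᵥ z := by
    rw [hsymm hSY.inv, ← dotProduct_add, hdiff]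
  have h3 := hsymm hSY.inv z η
  rw [mulVec_add (SX⁻¹ + SY⁻¹), hPn]
  simp only [add_dotProduct, dotProduct_add, h1, mulVec_add]
  rw [add_mulVec, dotProduct_add]
  linarith

/-- The convolution identity for two centered normal densities. -/
theorem integral_mvn_mul_mvn {d : ℕ} {SX SY : Matrix (Fin d) (Fin d) ℝ}
    (hSX : SX.PosDef) (hSY : SY.PosDef) (u w : Fin d → ℝ) :
    ∫ θ : Fin d → ℝ, mvn d SX (u - θ) * mvn d SY (w - θ) = mvn d (SX + SY) (w - u) := by
  have hX := hSX.det_pos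
  have hY := hSY.det_pos
  have hT := (hSX.add hSY).det_pos
  have hP := hSX.inv.add hSY.inv
  have hdet : (SX⁻¹ + SY⁻¹).det = SX.det⁻¹ * (SX + SY).det * SY.det⁻¹ := by
    have hfac : SX⁻¹ + SY⁻¹ = SX⁻¹ * (SX + SY) * SY⁻¹ := by
      rw [mul_add, add_mul, nonsing_inv_mul _ hX.ne'.isUnit, one_mul, mul_assoc,
        mul_nonsing_inv _ hY.ne'.isUnit, mul_one, add_comm]
    rw [hfac, det_mul, det_mul, det_nonsing_inv, det_nonsing_inv, Ring.inverse_eq_inv']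
  obtain ⟨n, hn⟩ : ∃ n : Fin d → ℝ, ∀ η : Fin d → ℝ,
      η ⬝ᵥ SX⁻¹ *ᵥ η + (w - u + η) ⬝ᵥ SY⁻¹ *ᵥ (w - u + η)
      = (η + n) ⬝ᵥ (SX⁻¹ + SY⁻¹) *ᵥ (η + n) + (w - u) ⬝ᵥ (SX + SY)⁻¹ *ᵥ (w - u) :=
    ⟨_, fun η => quadratic_add_quadratic_eq hSX hSY η (w - u)⟩
  have hprod (η : Fin d → ℝ) : mvn d SX η * mvn d SY (w - u + η)
      = ((2 * π) ^ (-(d : ℝ) / 2) * SX.det ^ (-(1 : ℝ) / 2)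
        * ((2 * π) ^ (-(d : ℝ) / 2) * SY.det ^ (-(1 : ℝ) / 2))
        * Real.exp (-((w - u) ⬝ᵥ (SX + SY)⁻¹ *ᵥ (w - u)) / 2))
        * Real.exp (-((η + n) ⬝ᵥ (SX⁻¹ + SY⁻¹) *ᵥ (η + n)) / 2) := by
    unfold mvn
    rw [mul_mul_mul_comm, ← Real.exp_add, mul_assoc _ (Real.exp _), ← Real.exp_add]
    congr 2
    linarith [hn η]
  calc ∫ θ : Fin d → ℝ, mvn d SX (u - θ) * mvn d SY (w - θ)
      = ∫ η : Fin d → ℝ, mvn d SX η * mvn d SY (w - u + η) := by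
        rw [← integral_sub_left_eq_self (fun η => mvn d SX η * mvn d SY (w - u + η)) volume u]
        simp
    _ = _ := by
        simp_rw [hprod]
        rw [integral_const_mul,
          integral_add_right_eq_self (fun η : Fin d → ℝ =>
            Real.exp (-(η ⬝ᵥ (SX⁻¹ + SY⁻¹) *ᵥ η) / 2)) n,
          integral_exp_neg_quadratic hP, hdet, mvn,
          Real.mul_rpow (x := SX.det⁻¹ * (SX + SY).det) (by positivity) (by positivity),
          Real.mul_rpow (x := SX.det⁻¹) (by positivity) (by positivity),
          Real.inv_rpow hX.le, Real.inv_rpow hY.le, neg_div (2 : ℝ) (d : ℝ),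
          Real.rpow_neg (by positivity)]
        have := Real.rpow_pos_of_pos hX (-(1 : ℝ) / 2)
        have := Real.rpow_pos_of_pos hY (-(1 : ℝ) / 2)
        have := Real.rpow_pos_of_pos (show 0 < 2 * π by positivity) ((d : ℝ) / 2)
        field_simp

theorem integrable_mvn_mul_mvn {d : ℕ} {SX SY : Matrix (Fin d) (Fin d) ℝ}
    (hSX : SX.PosDef) (hSY : SY.PosDef) (u w : Fin d → ℝ) :
    Integrable fun θ : Fin d → ℝ => mvn d SX (u - θ) * mvn d SY (w - θ) := by
  refine Integrable.of_integral_ne_zero ?_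
  rw [integral_mvn_mul_mvn hSX hSY]
  exact (mvn_pos (hSX.add hSY) _).ne'

/-- the Bayes predictive density under the improper uniform prior
(the minimum risk equivariant predictive density) for independent MMN observables is
the `MMN_d(x, a, Σ_X + Σ_Y, L₃)` density, where `L₃` is the law of `V₂ − V₁`:
`∫_{ℝ^d} p(x|θ) q(y|θ) dθ = ∫∫ φ_d(y − x − (v₂ − v₁)a; Σ_X + Σ_Y) dL₁(v₁) dL₂(v₂)`. -/
theorem mre_predictive_density_mmn
    (d : ℕ) (hd : 1 ≤ d) (a : Fin d → ℝ)
    (SX SY : Matrix (Fin d) (Fin d) ℝ) (hSX : SX.PosDef) (hSY : SY.PosDef)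
    (L₁ L₂ : Measure ℝ) [IsProbabilityMeasure L₁] [IsProbabilityMeasure L₂]
    (x y : Fin d → ℝ) :
    ∫ θ : Fin d → ℝ,
        (∫ v₁, mvn d SX (x - θ - v₁ • a) ∂L₁) * (∫ v₂, mvn d SY (y - θ - v₂ • a) ∂L₂)
      = ∫ v₁, ∫ v₂, mvn d (SX + SY) (y - x - (v₂ - v₁) • a) ∂L₂ ∂L₁ := by
  have hT := hSX.add hSY
  have hval (v : ℝ × ℝ) :
      ∫ θ : Fin d → ℝ, mvn d SX (x - θ - v.1 • a) * mvn d SY (y - θ - v.2 • a)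
        = mvn d (SX + SY) (y - x - (v.2 - v.1) • a) := by
    simp_rw [sub_right_comm _ _ (_ • a)]
    rw [integral_mvn_mul_mvn hSX hSY]
    congr 1
    module
  have hmix : Integrable (fun v : ℝ × ℝ => mvn d (SX + SY) (y - x - (v.2 - v.1) • a))
      (L₁.prod L₂) := integrable_mvn_comp hT _ (by fun_prop)
  have hint : Integrable (Function.uncurry fun (v : ℝ × ℝ) (θ : Fin d → ℝ) =>
      mvn d SX (x - θ - v.1 • a) * mvn d SY (y - θ - v.2 • a)) ((L₁.prod L₂).prod volume) := by
    have hX := continuous_mvn d SX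
    have hY := continuous_mvn d SY
    have hcont : Continuous (Function.uncurry fun (v : ℝ × ℝ) (θ : Fin d → ℝ) =>
        mvn d SX (x - θ - v.1 • a) * mvn d SY (y - θ - v.2 • a)) := by
      unfold Function.uncurry
      fun_prop
    refine (integrable_prod_iff hcont.aestronglyMeasurable).mpr
      ⟨Filter.Eventually.of_forall fun v => ?_, ?_⟩
    · refine Integrable.of_integral_ne_zero ?_
      simp only [Function.uncurry_apply_pair, hval]
      exact (mvn_pos hT _).ne'
    · refine hmix.congr (Filter.Eventually.of_forall fun v => ?_)
      simp only [Function.uncurry_apply_pair, ← hval]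
      refine integral_congr_ae (Filter.Eventually.of_forall fun θ => ?_)
      exact (Real.norm_of_nonneg (mul_pos (mvn_pos hSX _) (mvn_pos hSY _)).le).symm
  rw [← integral_prod _ hmix]
  simp_rw [← hval]
  rw [integral_integral_swap hint]
  exact integral_congr_ae (Filter.Eventually.of_forall fun θ => (integral_prod_mul _ _).symm)
end

section
/- Let d ≥ 1, a ∈ ℝ^d with a ≠ 0, σ_X², σ_Y² > 0 and σ_S² := σ_X² + σ_Y². Then for all x, y ∈ ℝ^d: ∫_ℝ (1/2) e^{−|t|} φ_d(y − x − a t; σ_S² I_d) dt = √(π σ_S²/(2‖a‖²)) · φ_d(y − x; σ_S² I_d) · exp(σ_S²/(2‖a‖²) + ((y−x)ᵀa)²/(2 σ_S² ‖a‖²)) · [ e^{−(y−x)ᵀa/‖a‖²} · Φ( (σ_S/‖a‖)((y−x)ᵀa/σ_S² − 1) ) + e^{(y−x)ᵀa/‖a‖²} · Φ( −(σ_S/‖a‖)((y−x)ᵀa/σ_S² + 1) ) ]. (The left side is the minimum risk equivariant predictive density when V₁, V₂ are i.i.d. standard exponential, since V₂ − V₁ then has the Laplace density (1/2)e^{−|t|}.)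 -/
open MeasureTheory Matrix Real

/-- The standard normal cdf `Φ` on `ℝ`. -/
noncomputable def stdPhi (t : ℝ) : ℝ := ∫ u in Set.Iic t, stdphi u

theorem integrable_stdphi : Integrable stdphi := by
  have h := (integrable_exp_neg_mul_sq (b := 1 / 2) (by norm_num)).div_const (√(2 * π))
  refine h.congr (.of_forall fun t => ?_)
  simp only [stdphi]
  ring_nf

theorem integral_Ioi_stdphi_sub_mul (m : ℝ) {k : ℝ} (hk : 0 < k) :
    ∫ t in Set.Ioi (0 : ℝ), stdphi (m - k * t) = k⁻¹ * stdPhi m := by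
  have hreflect : ∫ t in Set.Ioi (0 : ℝ), stdphi (m - t) = stdPhi m := by
    have h := ((volume : Measure ℝ).measurePreserving_sub_left m).setIntegral_preimage_emb
      (MeasurableEquiv.subLeft m).measurableEmbedding stdphi (Set.Iio m)
    rw [show (fun t => m - t) ⁻¹' Set.Iio m = Set.Ioi 0 by ext; simp] at h
    rw [h, stdPhi, integral_Iic_eq_integral_Iio]
  have h := integral_comp_mul_left_Ioi (fun t => stdphi (m - t)) 0 hk
  rw [mul_zero, hreflect] at h
  simpa using h

theorem exp_quadratic_eq_stdphi (b : ℝ) {k : ℝ} (hk : 0 < k) (t : ℝ) :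
    Real.exp (b * t - k ^ 2 * t ^ 2 / 2) =
      Real.exp (b ^ 2 / (2 * k ^ 2)) * √(2 * π) * stdphi (b / k - k * t) := by
  have hpi : √(2 * π) ≠ 0 := by positivity
  rw [stdphi, mul_assoc, mul_div_cancel₀ _ hpi, ← Real.exp_add]
  congr 1
  field_simp
  ring

theorem integrable_exp_quadratic (b : ℝ) {k : ℝ} (hk : 0 < k) :
    Integrable fun t : ℝ => Real.exp (b * t - k ^ 2 * t ^ 2 / 2) := by
  simp only [exp_quadratic_eq_stdphi b hk]
  exact ((integrable_stdphi.comp_sub_left (b / k)).comp_mul_left' hk.ne').const_mul _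

theorem integral_Ioi_exp_quadratic (b : ℝ) {k : ℝ} (hk : 0 < k) :
    ∫ t in Set.Ioi (0 : ℝ), Real.exp (b * t - k ^ 2 * t ^ 2 / 2) =
      Real.exp (b ^ 2 / (2 * k ^ 2)) * (√(2 * π) / k) * stdPhi (b / k) := by
  simp only [exp_quadratic_eq_stdphi b hk]
  rw [integral_const_mul, integral_Ioi_stdphi_sub_mul _ hk]
  ring

theorem integral_exp_neg_abs_mul_exp_quadratic (b : ℝ) {k : ℝ} (hk : 0 < k) :
    ∫ t : ℝ, Real.exp (-|t|) * Real.exp (b * t - k ^ 2 * t ^ 2 / 2) =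
      √(2 * π) / k * (Real.exp ((b - 1) ^ 2 / (2 * k ^ 2)) * stdPhi ((b - 1) / k) +
        Real.exp ((-b - 1) ^ 2 / (2 * k ^ 2)) * stdPhi ((-b - 1) / k)) := by
  have hpos : Set.EqOn (fun t : ℝ => Real.exp (-|t|) * Real.exp (b * t - k ^ 2 * t ^ 2 / 2))
      (fun t => Real.exp ((b - 1) * t - k ^ 2 * t ^ 2 / 2)) (Set.Ioi 0) := fun t ht => by
    simp only [abs_of_pos (Set.mem_Ioi.1 ht), ← Real.exp_add]
    ring_nf
  have hneg : Set.EqOn (fun t : ℝ => Real.exp (-|t|) * Real.exp (b * t - k ^ 2 * t ^ 2 / 2))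
      (fun t => Real.exp ((-b - 1) * -t - k ^ 2 * (-t) ^ 2 / 2)) (Set.Iic 0) := fun t ht => by
    simp only [abs_of_nonpos (Set.mem_Iic.1 ht), ← Real.exp_add]
    ring_nf
  rw [← intervalIntegral.integral_Iic_add_Ioi (b := 0)
      ((integrable_exp_quadratic (-b - 1) hk).comp_neg.integrableOn.congr_fun
        hneg.symm measurableSet_Iic)
      ((integrable_exp_quadratic (b - 1) hk).integrableOn.congr_fun hpos.symm measurableSet_Ioi),
    setIntegral_congr_fun measurableSet_Iic hneg, setIntegral_congr_fun measurableSet_Ioi hpos,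
    integral_comp_neg_Iic 0 (fun t => Real.exp ((-b - 1) * t - k ^ 2 * t ^ 2 / 2)), neg_zero,
    integral_Ioi_exp_quadratic _ hk, integral_Ioi_exp_quadratic _ hk]
  ring

theorem mvn_smul_one_sub_smul {d : ℕ} {s : ℝ} (hs : s ≠ 0) (w a : Fin d → ℝ) (t : ℝ) :
    mvn d (s • (1 : Matrix (Fin d) (Fin d) ℝ)) (w - t • a) =
      mvn d (s • (1 : Matrix (Fin d) (Fin d) ℝ)) w *
        Real.exp (w ⬝ᵥ a / s * t - a ⬝ᵥ a / s * t ^ 2 / 2) := by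
  have hinv : (s • (1 : Matrix (Fin d) (Fin d) ℝ))⁻¹ = s⁻¹ • 1 :=
    Matrix.inv_eq_right_inv (by simp [smul_smul, hs])
  simp only [mvn, hinv, smul_mulVec, one_mulVec, dotProduct_smul, sub_dotProduct, dotProduct_sub,
    smul_dotProduct, smul_eq_mul, dotProduct_comm a w]
  rw [mul_assoc _ (Real.exp _), ← Real.exp_add]
  congr 2
  field_simp
  ring

/-- closed form for the MRE predictive density with i.i.d. standard
exponential mixing (Laplace mixing density `(1/2)e^{−|t|}` for `V₂ − V₁`). -/
theorem mre_density_exponential_mixing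
    (d : ℕ) (hd : 1 ≤ d) (a : Fin d → ℝ) (ha : a ≠ 0)
    (sX2 sY2 sS2 : ℝ) (hX : 0 < sX2) (hY : 0 < sY2) (hS : sS2 = sX2 + sY2)
    (x y : Fin d → ℝ) :
    ∫ t : ℝ, (1 / 2) * Real.exp (-|t|) *
        mvn d (sS2 • (1 : Matrix (Fin d) (Fin d) ℝ)) (y - x - t • a)
      = Real.sqrt (π * sS2 / (2 * (a ⬝ᵥ a))) *
          mvn d (sS2 • (1 : Matrix (Fin d) (Fin d) ℝ)) (y - x) *
          Real.exp (sS2 / (2 * (a ⬝ᵥ a)) + ((y - x) ⬝ᵥ a) ^ 2 / (2 * sS2 * (a ⬝ᵥ a))) *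
          (Real.exp (-((y - x) ⬝ᵥ a) / (a ⬝ᵥ a)) *
              stdPhi ((Real.sqrt sS2 / Real.sqrt (a ⬝ᵥ a)) * (((y - x) ⬝ᵥ a) / sS2 - 1))
            + Real.exp (((y - x) ⬝ᵥ a) / (a ⬝ᵥ a)) *
              stdPhi (-(Real.sqrt sS2 / Real.sqrt (a ⬝ᵥ a)) * (((y - x) ⬝ᵥ a) / sS2 + 1))) := by
  have hs : 0 < sS2 := by linarith
  have hA : 0 < a ⬝ᵥ a := by
    simpa using (Matrix.dotProduct_self_star_pos_iff (v := a)).2 ha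
  simp only [mvn_smul_one_sub_smul hs.ne']
  generalize mvn d (sS2 • 1) (y - x) = M
  generalize (y - x) ⬝ᵥ a = c
  generalize a ⬝ᵥ a = A at hA ⊢
  have hk : 0 < √A / √sS2 := by positivity
  have hk2 : (√A / √sS2) ^ 2 = A / sS2 := by
    rw [div_pow, Real.sq_sqrt hA.le, Real.sq_sqrt hs.le]
  have hconst : √(π * sS2 / (2 * A)) = 1 / 2 * (√(2 * π) / (√A / √sS2)) := by
    rw [Real.sqrt_eq_iff_eq_sq (by positivity) (by positivity), mul_pow, div_pow _ (√A / √sS2), hk2,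
      Real.sq_sqrt (by positivity)]
    field_simp
  have h := integral_exp_neg_abs_mul_exp_quadratic (c / sS2) hk
  rw [hk2] at h
  have hint : ∀ t : ℝ, 1 / 2 * Real.exp (-|t|) *
      (M * Real.exp (c / sS2 * t - A / sS2 * t ^ 2 / 2)) =
      1 / 2 * M * (Real.exp (-|t|) * Real.exp (c / sS2 * t - A / sS2 * t ^ 2 / 2)) :=
    fun t => by ring
  have hexp_pos : Real.exp ((c / sS2 - 1) ^ 2 / (2 * (A / sS2))) =
      Real.exp (sS2 / (2 * A) + c ^ 2 / (2 * sS2 * A)) * Real.exp (-c / A) := by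
    rw [← Real.exp_add]
    congr 1
    field_simp
    ring
  have hexp_neg : Real.exp ((-(c / sS2) - 1) ^ 2 / (2 * (A / sS2))) =
      Real.exp (sS2 / (2 * A) + c ^ 2 / (2 * sS2 * A)) * Real.exp (c / A) := by
    rw [← Real.exp_add]
    congr 1
    field_simp
    ring
  have harg_pos : (c / sS2 - 1) / (√A / √sS2) = √sS2 / √A * (c / sS2 - 1) := by
    rw [div_div_eq_mul_div, mul_comm, mul_div_right_comm]
  have harg_neg : (-(c / sS2) - 1) / (√A / √sS2) = -(√sS2 / √A) * (c / sS2 + 1) := by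
    rw [div_div_eq_mul_div]
    ring
  simp only [hint]
  rw [integral_const_mul, h, hconst, hexp_pos, hexp_neg, harg_pos, harg_neg]
  ring
end

section
/- Let d ≥ 2, b ∈ ℝ^d, Σ a positive definite d×d matrix, and L a probability measure on ℝ. Define p_d(x) := ∫_ℝ φ_d(x − v b; Σ) dL(v) for x ∈ ℝ^d, and p₁(t) := ∫_ℝ φ(t − v √(bᵀΣ⁻¹b)) dL(v) for t ∈ ℝ. If p_d log p_d and p₁ log p₁ are Lebesgue integrable, then H(p_d) = H(p₁) + ((d−1)/2)(1 + log(2π)) + (1/2) log det Σ. -/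
open MeasureTheory Matrix Real

/-- `f` is a strictly positive probability density with respect to `μ` for which `f log f` is
integrable with integral `h`. -/
structure HasLogIntegral {α : Type*} [MeasurableSpace α] (μ : Measure α) (f : α → ℝ) (h : ℝ) :
    Prop where
  pos : ∀ x, 0 < f x
  integrable : Integrable f μ
  integral_eq_one : ∫ x, f x ∂μ = 1
  integrable_mul_log : Integrable (fun x => f x * Real.log (f x)) μ
  integral_mul_log : ∫ x, f x * Real.log (f x) ∂μ = h

namespace HasLogIntegral

variable {α β : Type*} [MeasurableSpace α] [MeasurableSpace β] {μ : Measure α} {ν : Measure β}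
  {f : α → ℝ} {g : β → ℝ} {h k : ℝ}

theorem prod [SFinite μ] [SFinite ν] (hf : HasLogIntegral μ f h) (hg : HasLogIntegral ν g k) :
    HasLogIntegral (μ.prod ν) (fun z : α × β => f z.1 * g z.2) (h + k) := by
  have hlog : (fun z : α × β => f z.1 * g z.2 * Real.log (f z.1 * g z.2)) =
      fun z => (f z.1 * Real.log (f z.1)) * g z.2 + f z.1 * (g z.2 * Real.log (g z.2)) := by
    ext z
    rw [Real.log_mul (hf.pos _).ne' (hg.pos _).ne']
    ring
  have h₁ : Integrable (fun z : α × β => (f z.1 * Real.log (f z.1)) * g z.2) (μ.prod ν) :=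
    hf.integrable_mul_log.mul_prod hg.integrable
  have h₂ : Integrable (fun z : α × β => f z.1 * (g z.2 * Real.log (g z.2))) (μ.prod ν) :=
    hf.integrable.mul_prod hg.integrable_mul_log
  refine ⟨fun z => mul_pos (hf.pos _) (hg.pos _), hf.integrable.mul_prod hg.integrable, ?_, ?_, ?_⟩
  · rw [integral_prod_mul, hf.integral_eq_one, hg.integral_eq_one, one_mul]
  · rw [hlog]
    exact h₁.add h₂
  · rw [hlog, integral_add h₁ h₂,
      integral_prod_mul (fun x => f x * Real.log (f x)) g,
      integral_prod_mul f (fun y => g y * Real.log (g y)), hf.integral_eq_one, hg.integral_eq_one,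
      hf.integral_mul_log, hg.integral_mul_log, mul_one, one_mul]

theorem comp_measurePreserving (hg : HasLogIntegral ν g k) (e : α ≃ᵐ β)
    (he : MeasurePreserving e μ ν) : HasLogIntegral μ (fun x => g (e x)) k := by
  refine ⟨fun x => hg.pos _, ?_, ?_, ?_, ?_⟩
  · exact (he.integrable_comp_emb e.measurableEmbedding).2 hg.integrable
  · rw [he.integral_comp e.measurableEmbedding, hg.integral_eq_one]
  · exact (he.integrable_comp_emb e.measurableEmbedding).2 hg.integrable_mul_log
  · rw [he.integral_comp e.measurableEmbedding (fun y => g y * Real.log (g y)),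
      hg.integral_mul_log]

theorem finCons {n : ℕ} {f : ℝ → ℝ} {g : (Fin n → ℝ) → ℝ} (hf : HasLogIntegral volume f h)
    (hg : HasLogIntegral volume g k) :
    HasLogIntegral volume (fun y : Fin (n + 1) → ℝ => f (y 0) * g (fun i => y i.succ)) (h + k) :=
  (hf.prod hg).comp_measurePreserving _
    (volume_preserving_piFinSuccAbove (fun _ : Fin (n + 1) => ℝ) 0)

theorem pi {f : ℝ → ℝ} (hf : HasLogIntegral volume f h) (n : ℕ) :
    HasLogIntegral volume (fun y : Fin n → ℝ => ∏ i, f (y i)) (n * h) := by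
  induction n with
  | zero =>
    refine ⟨fun _ => by simp, ?_, ?_, ?_, ?_⟩ <;>
      simp [measureReal_def, volume_pi]
  | succ n ih =>
    have := hf.finCons ih
    simp only [Fin.prod_univ_succ]
    convert this using 1
    push_cast
    ring

end HasLogIntegral

theorem stdphi_eq_gaussianPDFReal : stdphi = ProbabilityTheory.gaussianPDFReal 0 1 := by
  ext t
  simp [stdphi, ProbabilityTheory.gaussianPDFReal, div_eq_inv_mul]

theorem continuous_stdphi : Continuous stdphi := by
  unfold stdphi
  fun_prop

theorem stdphi_le (t : ℝ) : stdphi t ≤ 1 / Real.sqrt (2 * π) := by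
  unfold stdphi
  gcongr
  rw [Real.exp_le_one_iff]
  nlinarith [sq_nonneg t]

theorem integral_stdphi : ∫ t, stdphi t = 1 := by
  rw [stdphi_eq_gaussianPDFReal]
  exact ProbabilityTheory.integral_gaussianPDFReal_eq_one 0 one_ne_zero

theorem integrable_stdphi_mul_sq : Integrable (fun t => stdphi t * t ^ 2) := by
  have h := (integrable_rpow_mul_exp_neg_mul_sq (b := 1 / 2) (by norm_num) (s := 2)
    (by norm_num)).const_mul (Real.sqrt (2 * π))⁻¹
  refine h.congr (ae_of_all _ fun t => ?_)
  simp only [stdphi, Real.rpow_two]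
  rw [show -(t ^ 2) / 2 = -(1 / 2) * t ^ 2 by ring]
  ring

theorem integral_stdphi_mul_sq : ∫ t, stdphi t * t ^ 2 = 1 := by
  have h := ProbabilityTheory.variance_fun_id_gaussianReal (μ := 0) (v := 1)
  rw [ProbabilityTheory.variance_eq_integral (by fun_prop),
    ProbabilityTheory.integral_id_gaussianReal,
    ProbabilityTheory.integral_gaussianReal_eq_integral_smul one_ne_zero] at h
  simpa [stdphi_eq_gaussianPDFReal] using h

theorem hasLogIntegral_stdphi :
    HasLogIntegral volume stdphi (-(1 + Real.log (2 * π)) / 2) := by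
  have hlog : (fun t => stdphi t * Real.log (stdphi t)) =
      fun t => (-1 / 2) * (stdphi t * t ^ 2) + (-Real.log (2 * π) / 2) * stdphi t := by
    ext t
    have : Real.log (stdphi t) = -(t ^ 2) / 2 - Real.log (2 * π) / 2 := by
      rw [stdphi, Real.log_div (Real.exp_ne_zero _) (by positivity), Real.log_exp,
        Real.log_sqrt (by positivity)]
    rw [this]
    ring
  have h₁ := integrable_stdphi_mul_sq.const_mul (-1 / 2)
  have h₂ := integrable_stdphi.const_mul (-Real.log (2 * π) / 2)
  refine ⟨stdphi_pos, integrable_stdphi, integral_stdphi, ?_, ?_⟩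
  · rw [hlog]
    exact h₁.add h₂
  · rw [hlog, integral_add h₁ h₂, integral_const_mul, integral_const_mul, integral_stdphi,
      integral_stdphi_mul_sq]
    ring

section LocationMixture

variable (L : Measure ℝ) [IsProbabilityMeasure L] (c : ℝ)

theorem integrable_stdphi_location (t : ℝ) : Integrable (fun v => stdphi (t - v * c)) L := by
  refine Integrable.of_bound (C := 1 / Real.sqrt (2 * π)) ?_ (ae_of_all _ fun v => ?_)
  · exact (continuous_stdphi.comp (by fun_prop)).aestronglyMeasurable
  · rw [Real.norm_of_nonneg (stdphi_pos _).le]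
    exact stdphi_le _

theorem integral_stdphi_location_pos (t : ℝ) : 0 < ∫ v, stdphi (t - v * c) ∂L := by
  rw [integral_pos_iff_support_of_nonneg (fun v => (stdphi_pos _).le)
    (integrable_stdphi_location L c t)]
  have : Function.support (fun v => stdphi (t - v * c)) = Set.univ :=
    Set.eq_univ_of_forall fun v => (stdphi_pos _).ne'
  simp [this]

theorem integrable_prod_stdphi_location :
    Integrable (fun z : ℝ × ℝ => stdphi (z.2 - z.1 * c)) (L.prod volume) := by
  have hcont : Continuous fun z : ℝ × ℝ => stdphi (z.2 - z.1 * c) :=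
    continuous_stdphi.comp (by fun_prop)
  rw [integrable_prod_iff hcont.aestronglyMeasurable]
  refine ⟨ae_of_all _ fun v => integrable_stdphi.comp_sub_right (v * c), ?_⟩
  have : (fun v : ℝ => ∫ t, ‖stdphi (t - v * c)‖) = fun _ => 1 := by
    ext v
    simp_rw [Real.norm_of_nonneg (stdphi_pos _).le]
    rw [integral_sub_right_eq_self stdphi, integral_stdphi]
  simp only [this]
  exact integrable_const 1

theorem hasLogIntegral_stdphi_location
    (h : Integrable (fun t : ℝ =>
      (∫ v, stdphi (t - v * c) ∂L) * Real.log (∫ v, stdphi (t - v * c) ∂L))) :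
    HasLogIntegral volume (fun t => ∫ v, stdphi (t - v * c) ∂L)
      (∫ t, (∫ v, stdphi (t - v * c) ∂L) * Real.log (∫ v, stdphi (t - v * c) ∂L)) := by
  refine ⟨integral_stdphi_location_pos L c, ?_, ?_, h, rfl⟩
  · exact (integrable_prod_stdphi_location L c).integral_prod_right
  · have hswap := integral_integral_swap (f := fun v t => stdphi (t - v * c))
      (integrable_prod_stdphi_location L c)
    rw [← hswap]
    have : ∀ v : ℝ, ∫ t, stdphi (t - v * c) = 1 := fun v => by
      rw [integral_sub_right_eq_self stdphi, integral_stdphi]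
    simp [this]

end LocationMixture

/-- A Householder reflection maps any vector to a prescribed vector of the same length. -/
theorem exists_orthogonal_mulVec_eq {n : Type*} [Fintype n] [DecidableEq n] (w w' : n → ℝ)
    (h : w ⬝ᵥ w = w' ⬝ᵥ w') :
    ∃ U : Matrix n n ℝ, Uᵀ * U = 1 ∧ U *ᵥ w = w' := by
  by_cases hu : w - w' = 0
  · exact ⟨1, by simp, by simpa using sub_eq_zero.1 hu⟩
  have huu : (w - w') ⬝ᵥ (w - w') ≠ 0 := fun h0 => hu (dotProduct_self_eq_zero.1 h0)
  have huw : (w - w') ⬝ᵥ (w - w') = 2 * ((w - w') ⬝ᵥ w) := by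
    simp only [sub_dotProduct, dotProduct_sub, dotProduct_comm w' w, ← h]
    ring
  set u := w - w' with hu_def
  refine ⟨1 - (2 / (u ⬝ᵥ u)) • vecMulVec u u, ?_, ?_⟩
  · rw [transpose_sub, transpose_one, transpose_smul, transpose_vecMulVec]
    simp only [sub_mul, mul_sub, one_mul, mul_one, smul_mul_assoc, mul_smul_comm,
      vecMulVec_mul_vecMulVec, vecMulVec_smul, smul_smul]
    ext i j
    simp [vecMulVec_apply]
    field_simp
    ring
  · rw [sub_mulVec, one_mulVec, smul_mulVec, vecMulVec_mulVec]
    ext i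
    have huw' : u ⬝ᵥ w ≠ 0 := fun h0 => huu (by rw [huw, h0, mul_zero])
    simp [huw]
    field_simp
    simp [hu_def]

/-- Coordinates in which the precision matrix is the identity and `b` points along the first axis. -/
theorem Matrix.PosDef.exists_whitening {n : ℕ} {S : Matrix (Fin (n + 1)) (Fin (n + 1)) ℝ}
    (hS : S.PosDef) (b : Fin (n + 1) → ℝ) :
    ∃ M : Matrix (Fin (n + 1)) (Fin (n + 1)) ℝ, Mᵀ * M = S⁻¹ ∧
      M *ᵥ b = Pi.single 0 (Real.sqrt (b ⬝ᵥ S⁻¹ *ᵥ b)) := by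
  open scoped MatrixOrder in
  obtain ⟨B, hB⟩ := CStarAlgebra.nonneg_iff_eq_star_mul_self.mp hS.inv.posSemidef.nonneg
  rw [star_eq_conjTranspose, conjTranspose_eq_transpose_of_trivial] at hB
  have hBb : B *ᵥ b ⬝ᵥ B *ᵥ b = b ⬝ᵥ S⁻¹ *ᵥ b := by
    rw [hB, ← mulVec_mulVec, dotProduct_mulVec b Bᵀ, vecMul_transpose]
  have hnn : 0 ≤ b ⬝ᵥ S⁻¹ *ᵥ b := by
    rw [← hBb]
    exact Finset.sum_nonneg fun i _ => mul_self_nonneg _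
  obtain ⟨U, hU, hUb⟩ := exists_orthogonal_mulVec_eq (B *ᵥ b)
    (Pi.single 0 (Real.sqrt (b ⬝ᵥ S⁻¹ *ᵥ b))) (by
      rw [hBb, single_dotProduct, Pi.single_eq_same, Real.mul_self_sqrt hnn])
  refine ⟨U * B, ?_, by rw [← mulVec_mulVec, hUb]⟩
  rw [transpose_mul, Matrix.mul_assoc, ← Matrix.mul_assoc Uᵀ, hU, Matrix.one_mul, ← hB]

theorem abs_det_eq_of_transpose_mul_self_eq_inv {n : Type*} [Fintype n] [DecidableEq n]
    {S M : Matrix n n ℝ} (hS : S.PosDef) (hM : Mᵀ * M = S⁻¹) :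
    |M.det| = S.det ^ (-(1 : ℝ) / 2) := by
  have h : M.det ^ 2 = S.det⁻¹ := by
    rw [← Ring.inverse_eq_inv', ← det_nonsing_inv, ← hM, det_mul, det_transpose, sq]
  rw [← Real.sqrt_sq_eq_abs, h, Real.sqrt_eq_rpow, Real.inv_rpow hS.det_pos.le,
    ← Real.rpow_neg hS.det_pos.le, neg_div]

theorem mvn_eq_of_transpose_mul_self_eq_inv {d : ℕ} {S M : Matrix (Fin d) (Fin d) ℝ}
    (hM : Mᵀ * M = S⁻¹) (z : Fin d → ℝ) :
    mvn d S z = S.det ^ (-(1 : ℝ) / 2) * ∏ i, stdphi ((M *ᵥ z) i) := by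
  have hq : z ⬝ᵥ S⁻¹ *ᵥ z = ∑ i, (M *ᵥ z) i ^ 2 := by
    rw [← hM, ← mulVec_mulVec, dotProduct_mulVec z Mᵀ, vecMul_transpose]
    simp [dotProduct, sq]
  have hc : (2 * π) ^ (-(d : ℝ) / 2) = (Real.sqrt (2 * π) ^ d)⁻¹ := by
    rw [Real.sqrt_eq_rpow, ← Real.rpow_mul_natCast (by positivity),
      ← Real.rpow_neg (by positivity)]
    congr 1
    ring
  simp only [mvn, stdphi, Finset.prod_div_distrib, ← Real.exp_sum, hq, hc, Finset.prod_const,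
    Finset.card_univ, Fintype.card_fin, ← Finset.sum_div, Finset.sum_neg_distrib]
  rw [div_eq_mul_inv (Real.exp _)]
  ring

theorem integral_mvn_location {n : ℕ} {S M : Matrix (Fin (n + 1)) (Fin (n + 1)) ℝ}
    {b : Fin (n + 1) → ℝ} {c : ℝ} (hM : Mᵀ * M = S⁻¹) (hb : M *ᵥ b = Pi.single 0 c)
    (L : Measure ℝ) (x : Fin (n + 1) → ℝ) :
    ∫ v, mvn (n + 1) S (x - v • b) ∂L = S.det ^ (-(1 : ℝ) / 2) *
      ((∫ v, stdphi ((M *ᵥ x) 0 - v * c) ∂L) * ∏ i : Fin n, stdphi ((M *ᵥ x) i.succ)) := by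
  rw [← integral_mul_const, ← integral_const_mul]
  congr 1
  ext v
  rw [mvn_eq_of_transpose_mul_self_eq_inv hM, mulVec_sub, mulVec_smul, hb, Fin.prod_univ_succ]
  simp

/-- Change of variables for the integral of `f log f` under a linear map. -/
theorem HasLogIntegral.integral_comp_mulVec {n : Type*} [Fintype n] [DecidableEq n]
    {F : (n → ℝ) → ℝ} {h : ℝ} (hF : HasLogIntegral volume F h) {M : Matrix n n ℝ}
    (hM : M.det ≠ 0) :
    ∫ x, (|M.det| * F (M *ᵥ x)) * Real.log (|M.det| * F (M *ᵥ x)) = Real.log |M.det| + h := by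
  have hpos : 0 < |M.det| := abs_pos.2 hM
  set G : (n → ℝ) → ℝ := fun y => (|M.det| * Real.log |M.det|) * F y
    + |M.det| * (F y * Real.log (F y)) with hG
  have h₁ := hF.integrable.const_mul (|M.det| * Real.log |M.det|)
  have h₂ := hF.integrable_mul_log.const_mul |M.det|
  have hmap := Real.map_matrix_volume_pi_eq_smul_volume_pi hM
  calc ∫ x, (|M.det| * F (M *ᵥ x)) * Real.log (|M.det| * F (M *ᵥ x))
      = ∫ x, G (toLin' M x) := by
        congr 1
        ext x
        rw [Real.log_mul hpos.ne' (hF.pos _).ne', hG, toLin'_apply]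
        ring
    _ = ∫ y, G y ∂(Measure.map (toLin' M) volume) := by
        refine (integral_map ?_ ?_).symm
        · exact (LinearMap.continuous_of_finiteDimensional _).aemeasurable
        · rw [hmap]
          exact (h₁.add h₂).aestronglyMeasurable.smul_measure _
    _ = |M.det|⁻¹ * ∫ y, G y := by
        rw [hmap, integral_smul_measure, ENNReal.toReal_ofReal (abs_nonneg _), abs_inv,
          smul_eq_mul]
    _ = Real.log |M.det| + h := by
        rw [hG, integral_add h₁ h₂, integral_const_mul, integral_const_mul, hF.integral_eq_one,
          hF.integral_mul_log]
        field_simp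

/-- dimension-reduction decomposition of the differential entropy of an
`MMN_d(0, b, Σ, L)` density:
`H(p_d) = H(p₁) + ((d−1)/2)(1 + log(2π)) + (1/2) log det Σ`, where `p₁` is the
`MMN₁(0, √(bᵀΣ⁻¹b), 1, L)` density. -/
theorem mmn_entropy_decomposition
    (d : ℕ) (hd : 2 ≤ d) (b : Fin d → ℝ)
    (S : Matrix (Fin d) (Fin d) ℝ) (hS : S.PosDef)
    (L : Measure ℝ) [IsProbabilityMeasure L]
    (pd : (Fin d → ℝ) → ℝ) (p₁ : ℝ → ℝ)
    (hpd : pd = fun x => ∫ v, mvn d S (x - v • b) ∂L)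
    (hp₁ : p₁ = fun t => ∫ v, stdphi (t - v * Real.sqrt (b ⬝ᵥ S⁻¹ *ᵥ b)) ∂L)
    (hint_d : Integrable (fun x : Fin d → ℝ => pd x * Real.log (pd x)))
    (hint_1 : Integrable (fun t : ℝ => p₁ t * Real.log (p₁ t))) :
    -∫ x : Fin d → ℝ, pd x * Real.log (pd x)
      = (-∫ t : ℝ, p₁ t * Real.log (p₁ t))
          + ((d : ℝ) - 1) / 2 * (1 + Real.log (2 * π)) + (1 / 2) * Real.log S.det := by
  obtain ⟨n, rfl⟩ : ∃ n, d = n + 1 := ⟨d - 1, by omega⟩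
  obtain ⟨M, hM, hMb⟩ := hS.exists_whitening b
  have habs := abs_det_eq_of_transpose_mul_self_eq_inv hS hM
  have hdet : M.det ≠ 0 := abs_pos.1 (habs ▸ Real.rpow_pos_of_pos hS.det_pos _)
  subst hp₁
  have hF := (hasLogIntegral_stdphi_location L _ hint_1).finCons (hasLogIntegral_stdphi.pi n)
  have key := hF.integral_comp_mulVec hdet
  have hlog : Real.log |M.det| = -(1 / 2) * Real.log S.det := by
    rw [habs, Real.log_rpow hS.det_pos]
    ring
  rw [hlog, habs] at key
  simp only [hpd, integral_mvn_location hM hMb]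
  rw [key]
  push_cast
  ring
end

section
/- In the setting of the normal-prior posterior for the MMN model — p(x|θ) = ∫_ℝ φ_d(x − θ − v a; Σ) g(v) dv, prior π(θ) = φ_d(θ − μ; Δ), P := Σ(Σ + Δ)⁻¹, A := aᵀ(Σ + Δ)⁻¹a, B := (x − μ)ᵀ(Σ + Δ)⁻¹a, g_{π,x}(v) := g(v) e^{−Av²/2 + Bv} / ∫ g(u) e^{−Au²/2 + Bu} du — assume additionally ∫_ℝ |v| g_{π,x}(v) dv < ∞. Then the posterior mean satisfies ∫_{ℝ^d} θ · π(θ|x) dθ = (I − P)x + Pμ − (I − P)a · ∫_ℝ v g_{π,x}(v) dv, where π(θ|x) = φ_d(θ − μ; Δ) p(x|θ) / ∫ φ_d(θ' − μ; Δ) p(x|θ') dθ'. -/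
open MeasureTheory Matrix Real

lemma Matrix.PosDef.exists_mul_norm_sq_le {n : Type*} [Fintype n] {M : Matrix n n ℝ}
    (hM : M.PosDef) : ∃ c : ℝ, 0 < c ∧ ∀ z : n → ℝ, c * ‖z‖ ^ 2 ≤ z ⬝ᵥ M *ᵥ z := by
  have hcont : Continuous fun z : n → ℝ => z ⬝ᵥ M *ᵥ z := by fun_prop
  rcases (Metric.sphere (0 : n → ℝ) 1).eq_empty_or_nonempty with he | hne
  · refine ⟨1, one_pos, fun z => ?_⟩
    have hz : z = 0 := by
      by_contra hz
      have : ‖z‖⁻¹ • z ∈ Metric.sphere (0 : n → ℝ) 1 := by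
        simp [norm_smul, inv_mul_cancel₀ (norm_ne_zero_iff.2 hz)]
      simp [he] at this
    simp [hz]
  · obtain ⟨w, hw, hmin⟩ := (isCompact_sphere (0 : n → ℝ) 1).exists_isMinOn hne hcont.continuousOn
    have hw0 : w ≠ 0 := by
      rintro rfl
      simp at hw
    refine ⟨w ⬝ᵥ M *ᵥ w, by simpa using hM.dotProduct_mulVec_pos hw0, fun z => ?_⟩
    rcases eq_or_ne z 0 with rfl | hz
    · simp
    have hz' : ‖z‖ ≠ 0 := norm_ne_zero_iff.2 hz
    have hmem : ‖z‖⁻¹ • z ∈ Metric.sphere (0 : n → ℝ) 1 := by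
      simp [norm_smul, inv_mul_cancel₀ hz']
    have h := hmin hmem
    simp only [Set.mem_ofPred_eq, mulVec_smul, dotProduct_smul, smul_dotProduct, smul_eq_mul] at h
    calc _ ≤ (‖z‖⁻¹ * (‖z‖⁻¹ * (z ⬝ᵥ M *ᵥ z))) * ‖z‖ ^ 2 := by gcongr
      _ = _ := by field_simp

lemma one_add_pow_mul_exp_neg_sq_le {c t : ℝ} (hc : 0 < c) (ht : 0 ≤ t) (n : ℕ) :
    (1 + t) ^ n * rexp (-(c * t ^ 2) / 2) ≤ n.factorial * rexp (1 + 1 / (2 * c)) := by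
  have h1 : (1 + t) ^ n ≤ n.factorial * rexp (1 + t) := by
    have := Real.pow_div_factorial_le_exp (x := 1 + t) (by positivity) n
    rwa [div_le_iff₀' (by positivity)] at this
  have h2 : 1 + t + -(c * t ^ 2) / 2 ≤ 1 + 1 / (2 * c) := by
    have : 1 / (2 * c) - t + c * t ^ 2 / 2 = (c * t - 1) ^ 2 / (2 * c) := by
      field_simp
      ring
    have : 0 ≤ (c * t - 1) ^ 2 / (2 * c) := by positivity
    linarith
  calc _ ≤ n.factorial * rexp (1 + t) * rexp (-(c * t ^ 2) / 2) := by gcongr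
    _ = n.factorial * rexp (1 + t + -(c * t ^ 2) / 2) := by rw [mul_assoc, ← Real.exp_add]
    _ ≤ _ := by gcongr

lemma integrable_one_add_norm_mul_exp_neg_quadratic {n : Type*} [Fintype n] {M : Matrix n n ℝ}
    (hM : M.PosDef) :
    Integrable fun z : n → ℝ => (1 + ‖z‖) * rexp (-(z ⬝ᵥ M *ᵥ z) / 2) := by
  obtain ⟨c, hc, hcM⟩ := hM.exists_mul_norm_sq_le
  have hr : (Module.finrank ℝ (n → ℝ) : ℝ) < (Fintype.card n + 1 : ℕ) := by simp
  refine ((integrable_one_add_norm (μ := volume) hr).const_mul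
    ((Fintype.card n + 2).factorial * rexp (1 + 1 / (2 * c)))).mono' ?_ (.of_forall fun z => ?_)
  · exact Continuous.aestronglyMeasurable (by fun_prop)
  · have hp : (0 : ℝ) < 1 + ‖z‖ := by positivity
    rw [Real.norm_of_nonneg (by positivity), Real.rpow_neg hp.le, Real.rpow_natCast,
      ← div_eq_mul_inv, le_div_iff₀ (by positivity)]
    calc _ = (1 + ‖z‖) ^ (Fintype.card n + 2) * rexp (-(z ⬝ᵥ M *ᵥ z) / 2) := by ring
      _ ≤ (1 + ‖z‖) ^ (Fintype.card n + 2) * rexp (-(c * ‖z‖ ^ 2) / 2) := by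
        gcongr
        exact hcM z
      _ ≤ _ := one_add_pow_mul_exp_neg_sq_le hc (norm_nonneg z) _

lemma integrable_exp_neg_quadratic {n : Type*} [Fintype n] {M : Matrix n n ℝ} (hM : M.PosDef) :
    Integrable fun z : n → ℝ => rexp (-(z ⬝ᵥ M *ᵥ z) / 2) := by
  refine (integrable_one_add_norm_mul_exp_neg_quadratic hM).mono'
    (Continuous.aestronglyMeasurable (by fun_prop)) (.of_forall fun z => ?_)
  rw [Real.norm_of_nonneg (by positivity)]
  exact le_mul_of_one_le_left (by positivity) (by simp)

lemma integrable_exp_neg_quadratic_smul {n : Type*} [Fintype n] {M : Matrix n n ℝ}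
    (hM : M.PosDef) :
    Integrable fun z : n → ℝ => rexp (-(z ⬝ᵥ M *ᵥ z) / 2) • z := by
  refine (integrable_one_add_norm_mul_exp_neg_quadratic hM).mono'
    (Continuous.aestronglyMeasurable (by fun_prop)) (.of_forall fun z => ?_)
  rw [norm_smul, Real.norm_of_nonneg (by positivity), mul_comm]
  gcongr
  simp

lemma integral_smul_self_of_even {E : Type*} [NormedAddCommGroup E] [NormedSpace ℝ E]
    [MeasurableSpace E] [BorelSpace E] (ν : Measure E) [ν.IsNegInvariant]
    {k : E → ℝ} (hk : ∀ z, k (-z) = k z) : ∫ z, k z • z ∂ν = 0 := by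
  have h := integral_neg_eq_self (fun z => k z • z) ν
  simp only [hk, smul_neg, integral_neg] at h
  have h2 : (2 : ℝ) • ∫ z, k z • z ∂ν = 0 := by
    rw [two_smul]
    nth_rewrite 1 [← h]
    exact neg_add_cancel _
  exact (smul_eq_zero.1 h2).resolve_left two_ne_zero

section Mixture

variable {E : Type*} [NormedAddCommGroup E] [NormedSpace ℝ E] [FiniteDimensional ℝ E]
  [MeasurableSpace E] [BorelSpace E] {ν : Measure E} [ν.IsAddHaarMeasure]
  {h : ℝ → ℝ} {k : E → ℝ}

lemma measurePreserving_prod_sub_affine (b c : E) :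
    MeasurePreserving (fun p : ℝ × E => (p.1, p.2 - (b - p.1 • c)))
      ((volume : Measure ℝ).prod ν) ((volume : Measure ℝ).prod ν) := by
  refine (MeasurePreserving.id (volume : Measure ℝ)).skew_product
    (g := fun v θ => θ - (b - v • c)) ?_ (.of_forall fun v => ?_)
  · exact Continuous.measurable (by fun_prop)
  · exact (measurePreserving_sub_right ν (b - v • c)).map_eq

/-- Total mass of the mixture of the translates of `k` by `b - v • c` with weights `h v`. -/
lemma integral_location_mixture (hh : Integrable h) (hk : Integrable k ν) (b c : E) :
    ∫ θ, (∫ v, h v * k (θ - (b - v • c))) ∂ν = (∫ v, h v) * ∫ z, k z ∂ν := by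
  have hint : Integrable (Function.uncurry fun v θ => h v * k (θ - (b - v • c)))
      ((volume : Measure ℝ).prod ν) :=
    (measurePreserving_prod_sub_affine b c).integrable_comp_of_integrable (hh.mul_prod hk)
  rw [← integral_integral_swap hint]
  simp_rw [integral_const_mul, integral_sub_right_eq_self k, integral_mul_const]

/-- First moment of the mixture of the translates of an even `k` by `b - v • c` with
weights `h v`. -/
lemma integral_location_mixture_smul (hh : Integrable h) (hvh : Integrable fun v => v * h v)
    (hk : Integrable k ν) (hkz : Integrable (fun z => k z • z) ν) (heven : ∀ z, k (-z) = k z)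
    (b c : E) :
    ∫ θ, (∫ v, h v * k (θ - (b - v • c))) • θ ∂ν
      = (∫ z, k z ∂ν) • ((∫ v, h v) • b - (∫ v, v * h v) • c) := by
  have hm : Integrable fun v => h v • b - (v * h v) • c :=
    (hh.smul_const b).sub (hvh.smul_const c)
  have hint : Integrable (Function.uncurry fun v θ => (h v * k (θ - (b - v • c))) • θ)
      ((volume : Measure ℝ).prod ν) := by
    have hG : Integrable (fun p : ℝ × E => h p.1 • (k p.2 • p.2)
        + k p.2 • (h p.1 • b - (p.1 * h p.1) • c)) ((volume : Measure ℝ).prod ν) :=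
      (hh.smul_prod hkz).add (hk.smul_prod hm).swap
    refine ((measurePreserving_prod_sub_affine b c).integrable_comp_of_integrable hG).congr
      (.of_forall fun p => ?_)
    simp only [Function.comp, Function.uncurry]
    module
  have hinner : ∀ v, ∫ θ, (h v * k (θ - (b - v • c))) • θ ∂ν
      = (∫ z, k z ∂ν) • (h v • b - (v * h v) • c) := by
    intro v
    calc ∫ θ, (h v * k (θ - (b - v • c))) • θ ∂ν
        = ∫ θ, (fun z => h v • (k z • z) + k z • (h v • b - (v * h v) • c))
            (θ - (b - v • c)) ∂ν := by
          congr 1 with θ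
          module
      _ = ∫ z, (h v • (k z • z) + k z • (h v • b - (v * h v) • c)) ∂ν :=
          integral_sub_right_eq_self (fun z => h v • (k z • z) + k z • (h v • b - (v * h v) • c)) _
      _ = _ := by
          rw [integral_add (f := fun z => h v • (k z • z)) (hkz.smul (h v)) (hk.smul_const _),
            integral_smul,
            integral_smul_self_of_even ν heven, integral_smul_const, smul_zero, zero_add]
  calc ∫ θ, (∫ v, h v * k (θ - (b - v • c))) • θ ∂ν
      = ∫ θ, (∫ v, (h v * k (θ - (b - v • c))) • θ) ∂ν := by simp_rw [integral_smul_const]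
    _ = ∫ v, (∫ z, k z ∂ν) • (h v • b - (v * h v) • c) := by
        rw [← integral_integral_swap hint]
        simp_rw [hinner]
    _ = _ := ?_
  rw [integral_smul, integral_sub (hh.smul_const b) (hvh.smul_const c), integral_smul_const,
    integral_smul_const]

end Mixture

lemma Matrix.IsSymm.dotProduct_mulVec_comm {n R : Type*} [Fintype n] [CommRing R]
    {M : Matrix n n R} (hM : M.IsSymm) (u w : n → R) : u ⬝ᵥ M *ᵥ w = w ⬝ᵥ M *ᵥ u := by
  rw [dotProduct_mulVec, ← mulVec_transpose, hM.eq, dotProduct_comm]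

lemma Matrix.PosDef.isSymm_real {n : Type*} {M : Matrix n n ℝ} (hM : M.PosDef) : M.IsSymm :=
  (conjTranspose_eq_transpose_of_trivial M).symm.trans hM.isHermitian

lemma Matrix.PosDef.inv_quadratic_mulVec_add {n : Type*} [Fintype n] [DecidableEq n]
    {M : Matrix n n ℝ} (hM : M.PosDef) (t e : n → ℝ) :
    (M *ᵥ t + e) ⬝ᵥ M⁻¹ *ᵥ (M *ᵥ t + e)
      = t ⬝ᵥ M *ᵥ t + 2 * (t ⬝ᵥ e) + e ⬝ᵥ M⁻¹ *ᵥ e := by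
  have hdet : IsUnit M.det := (isUnit_iff_isUnit_det M).1 hM.isUnit
  have h : M⁻¹ *ᵥ (M *ᵥ t) = t := by rw [mulVec_mulVec, nonsing_inv_mul M hdet, one_mulVec]
  have h2 : (M *ᵥ t) ⬝ᵥ M⁻¹ *ᵥ e = t ⬝ᵥ e := by
    rw [hM.inv.isSymm_real.dotProduct_mulVec_comm, h, dotProduct_comm]
  rw [mulVec_add, add_dotProduct, dotProduct_add, dotProduct_add, h, h2,
    dotProduct_comm (M *ᵥ t) t, dotProduct_comm e t]
  ring

/-- Completing the square in the product of two Gaussian exponents. -/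
lemma Matrix.PosDef.inv_quadratic_add_inv_quadratic {n : Type*} [Fintype n] [DecidableEq n]
    {S D : Matrix n n ℝ} (hS : S.PosDef) (hD : D.PosDef) (z u : n → ℝ) :
    z ⬝ᵥ D⁻¹ *ᵥ z + (u - z) ⬝ᵥ S⁻¹ *ᵥ (u - z)
      = u ⬝ᵥ (S + D)⁻¹ *ᵥ u
        + (z - D *ᵥ (S + D)⁻¹ *ᵥ u) ⬝ᵥ (S⁻¹ + D⁻¹) *ᵥ (z - D *ᵥ (S + D)⁻¹ *ᵥ u) := by
  have hdet : IsUnit (S + D).det := (isUnit_iff_isUnit_det _).1 (hS.add hD).isUnit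
  obtain ⟨t, rfl⟩ : ∃ t, (S + D) *ᵥ t = u :=
    ⟨(S + D)⁻¹ *ᵥ u, by rw [mulVec_mulVec, mul_nonsing_inv _ hdet, one_mulVec]⟩
  have ht : (S + D)⁻¹ *ᵥ ((S + D) *ᵥ t) = t := by
    rw [mulVec_mulVec, nonsing_inv_mul _ hdet, one_mulVec]
  obtain ⟨e, rfl⟩ : ∃ e, D *ᵥ t + e = z := ⟨z - D *ᵥ t, by abel⟩
  have hw : (S + D) *ᵥ t - (D *ᵥ t + e) = S *ᵥ t + -e := by
    rw [add_mulVec]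
    abel
  rw [ht, hw, hD.inv_quadratic_mulVec_add, hS.inv_quadratic_mulVec_add, add_sub_cancel_left,
    dotProduct_comm _ t]
  simp only [add_mulVec, dotProduct_add, dotProduct_neg, mulVec_neg, neg_dotProduct]
  ring

lemma mvn_mul_mvn {d : ℕ} {S D : Matrix (Fin d) (Fin d) ℝ} (hS : S.PosDef) (hD : D.PosDef)
    (a μ x : Fin d → ℝ) :
    ∃ C : ℝ, 0 < C ∧ ∀ θ (v : ℝ), mvn d D (θ - μ) * mvn d S (x - θ - v • a)
      = C * (rexp (-(a ⬝ᵥ (S + D)⁻¹ *ᵥ a) * v ^ 2 / 2 + ((x - μ) ⬝ᵥ (S + D)⁻¹ *ᵥ a) * v)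
        * (fun z => rexp (-(z ⬝ᵥ (S⁻¹ + D⁻¹) *ᵥ z) / 2))
            (θ - (μ + D *ᵥ (S + D)⁻¹ *ᵥ (x - μ) - v • (D *ᵥ (S + D)⁻¹ *ᵥ a)))) := by
  have hSd := hS.det_pos
  have hDd := hD.det_pos
  refine ⟨((2 * π) ^ (-(d : ℝ) / 2) * D.det ^ (-(1 : ℝ) / 2))
    * ((2 * π) ^ (-(d : ℝ) / 2) * S.det ^ (-(1 : ℝ) / 2))
    * rexp (-((x - μ) ⬝ᵥ (S + D)⁻¹ *ᵥ (x - μ)) / 2), by positivity, fun θ v => ?_⟩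
  have hsq := hS.inv_quadratic_add_inv_quadratic hD (θ - μ) (x - μ - v • a)
  have hu : (x - μ - v • a) ⬝ᵥ (S + D)⁻¹ *ᵥ (x - μ - v • a)
      = (x - μ) ⬝ᵥ (S + D)⁻¹ *ᵥ (x - μ) - 2 * v * ((x - μ) ⬝ᵥ (S + D)⁻¹ *ᵥ a)
        + v ^ 2 * (a ⬝ᵥ (S + D)⁻¹ *ᵥ a) := by
    have hc := (hS.add hD).inv.isSymm_real.dotProduct_mulVec_comm a (x - μ)
    generalize x - μ = y at *
    simp only [mulVec_sub, mulVec_smul, dotProduct_sub, sub_dotProduct, dotProduct_smul,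
      smul_dotProduct, smul_eq_mul, hc]
    ring
  have hw : x - μ - v • a - (θ - μ) = x - θ - v • a := by abel
  have he : θ - μ - D *ᵥ (S + D)⁻¹ *ᵥ (x - μ - v • a)
      = θ - (μ + D *ᵥ (S + D)⁻¹ *ᵥ (x - μ) - v • (D *ᵥ (S + D)⁻¹ *ᵥ a)) := by
    rw [mulVec_sub _ (x - μ), mulVec_sub D, mulVec_smul, mulVec_smul]
    abel
  rw [hw, he, hu] at hsq
  simp only [mvn]
  rw [mul_mul_mul_comm, ← Real.exp_add, mul_assoc (_ * _) (rexp _), ← Real.exp_add,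
    ← Real.exp_add]
  congr 2
  linarith

/-- the posterior mean for the MMN model with a normal prior is
`(I − P)x + Pμ − (I − P)a · ∫ v g_{π,x}(v) dv`. -/
theorem mmn_posterior_mean
    (d : ℕ) (hd : 1 ≤ d) (a μ : Fin d → ℝ)
    (S D : Matrix (Fin d) (Fin d) ℝ) (hS : S.PosDef) (hD : D.PosDef)
    (g : ℝ → ℝ) (hgmeas : Measurable g) (hgpos : ∀ v, 0 ≤ g v)
    (hgnorm : ∫ v : ℝ, g v = 1)
    (x : Fin d → ℝ)
    (P : Matrix (Fin d) (Fin d) ℝ) (hP : P = S * (S + D)⁻¹)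
    (A B : ℝ) (hA : A = a ⬝ᵥ (S + D)⁻¹ *ᵥ a) (hB : B = (x - μ) ⬝ᵥ (S + D)⁻¹ *ᵥ a)
    (Ng : ℝ) (hNg : Ng = ∫ u : ℝ, g u * Real.exp (-A * u ^ 2 / 2 + B * u))
    (hNgInt : Integrable (fun u : ℝ => g u * Real.exp (-A * u ^ 2 / 2 + B * u)))
    (hNgpos : 0 < Ng)
    (gpix : ℝ → ℝ) (hgpix : gpix = fun v => g v * Real.exp (-A * v ^ 2 / 2 + B * v) / Ng)
    (hmoment : ∫⁻ v : ℝ, ENNReal.ofReal (|v| * gpix v) < ⊤)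
    (px : (Fin d → ℝ) → ℝ)
    (hpx : px = fun θ => ∫ v : ℝ, mvn d S (x - θ - v • a) * g v)
    (post : (Fin d → ℝ) → ℝ)
    (hpost : post = fun θ =>
        mvn d D (θ - μ) * px θ / ∫ θ' : Fin d → ℝ, mvn d D (θ' - μ) * px θ') :
    ∫ θ : Fin d → ℝ, post θ • θ
      = (1 - P) *ᵥ x + P *ᵥ μ - (∫ v : ℝ, v * gpix v) • ((1 - P) *ᵥ a) := by
  have hdet : IsUnit (S + D).det := (isUnit_iff_isUnit_det _).1 (hS.add hD).isUnit
  obtain ⟨C, hC, hprod⟩ := mvn_mul_mvn hS hD a μ x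
  rw [← hA, ← hB] at hprod
  have hM : (S⁻¹ + D⁻¹).PosDef := hS.inv.add hD.inv
  have h1P : 1 - P = D * (S + D)⁻¹ := by
    rw [hP, sub_eq_iff_eq_add, ← add_mul, add_comm D S, mul_nonsing_inv _ hdet]
  set b := μ + D *ᵥ (S + D)⁻¹ *ᵥ (x - μ) with hb
  set c := D *ᵥ (S + D)⁻¹ *ᵥ a with hc
  set k : (Fin d → ℝ) → ℝ := fun z => rexp (-(z ⬝ᵥ (S⁻¹ + D⁻¹) *ᵥ z) / 2) with hk
  have hkint : Integrable k := integrable_exp_neg_quadratic hM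
  have hkpos : 0 < ∫ z, k z := integral_exp_pos hkint
  have heven : ∀ z, k (-z) = k z := fun z => by simp [hk, mulVec_neg]
  set h : ℝ → ℝ := fun u => g u * rexp (-A * u ^ 2 / 2 + B * u) with hh
  have hgh : ∀ v, h v = Ng * gpix v := fun v => by
    rw [hgpix]
    exact (mul_div_cancel₀ _ hNgpos.ne').symm
  have hgpix0 : ∀ v, 0 ≤ gpix v := fun v => by
    rw [hgpix]
    have := hgpos v
    positivity
  have hgpixm : Measurable gpix := by
    rw [hgpix]
    fun_prop
  have hvg : Integrable fun v => v * gpix v := by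
    refine ⟨by fun_prop, ?_⟩
    rw [hasFiniteIntegral_iff_norm]
    simpa [abs_mul, abs_of_nonneg (hgpix0 _)] using hmoment
  have hvh : Integrable fun v => v * h v := by
    simpa only [hgh, mul_left_comm] using hvg.const_mul Ng
  have hvh_eq : ∫ v, v * h v = Ng * ∫ v, v * gpix v := by
    simp_rw [hgh, mul_left_comm _ Ng, integral_const_mul]
  have hnum : ∀ θ, mvn d D (θ - μ) * px θ = C * ∫ v, h v * k (θ - (b - v • c)) := fun θ => by
    rw [hpx, ← integral_const_mul, ← integral_const_mul]
    congr 1 with v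
    rw [← mul_assoc, hprod]
    ring
  have hpost' : ∀ θ, post θ • θ
      = (Ng * ∫ z, k z)⁻¹ • ((∫ v, h v * k (θ - (b - v • c))) • θ) := fun θ => by
    simp only [hpost, hnum]
    rw [integral_const_mul, integral_location_mixture hNgInt hkint, ← hNg,
      mul_div_mul_left _ _ hC.ne', div_eq_inv_mul, mul_smul]
  simp_rw [hpost']
  rw [integral_smul, integral_location_mixture_smul hNgInt hvh hkint
    (integrable_exp_neg_quadratic_smul hM) heven, ← hNg, hvh_eq, h1P, mul_smul Ng, ← smul_sub,
    smul_smul, smul_smul, mul_assoc, mul_comm (∫ z, k z) Ng, inv_mul_cancel₀ (by positivity),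
    one_smul]
  have hPμ : P *ᵥ μ = μ - (D * (S + D)⁻¹) *ᵥ μ := by
    rw [← h1P, sub_mulVec, one_mulVec, sub_sub_cancel]
  rw [hPμ, hb, hc, mulVec_mulVec, mulVec_mulVec, mulVec_sub]
  abel
end

section
/- Let d ≥ 2, a ∈ ℝ^d with a ≠ 0, σ_X², σ_Y² > 0, σ_S² := σ_X² + σ_Y², L₁, L₂ probability measures on ℝ, model densities p(x|θ) = ∫ φ_d(x − θ − v₁a; σ_X² I_d) dL₁(v₁) and q(y|θ) = ∫ φ_d(y − θ − v₂a; σ_Y² I_d) dL₂(v₂). Let H be an orthogonal d×d matrix with first row h₁ᵀ = aᵀ/‖a‖ and remaining rows H₂, and let π₀ : ℝ^{d−1} → [0, ∞) be measurable with 0 < ∫ φ_{d−1}(z − ζ; σ_X² I_{d−1}) π₀(ζ) dζ < ∞ for every z ∈ ℝ^{d−1}. Consider the (possibly improper) prior π(θ) = π₀(H₂θ) and the Bayes predictive density q̂_π(y; x) := ∫_{ℝ^d} q(y|θ) p(x|θ) π(θ) dθ / ∫_{ℝ^d} p(x|θ) π(θ) dθ. Then for all x, y ∈ ℝ^d: q̂_π(y;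 x) = q̂_U¹(h₁ᵀy; h₁ᵀx) · q̂'_{π₀}(H₂y; H₂x), where q̂_U¹(t; s) := ∫_{ℝ²} (1/σ_S) φ((t − s − (v₂ − v₁)‖a‖)/σ_S) dL₁(v₁) dL₂(v₂) and q̂'_{π₀}(w; z) := ∫ φ_{d−1}(w − ζ; σ_Y² I_{d−1}) φ_{d−1}(z − ζ; σ_X² I_{d−1}) π₀(ζ) dζ / ∫ φ_{d−1}(z − ζ; σ_X² I_{d−1}) π₀(ζ) dζ. -/
open MeasureTheory Matrix Real

namespace CenteredGaussian

/-- The density at `t` of the centered normal law on `ℝ` with variance `s`. -/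
noncomputable def pdf (s t : ℝ) : ℝ := (√(2 * π * s))⁻¹ * Real.exp (-t ^ 2 / (2 * s))

lemma pdf_eq_gaussianPDFReal {s : ℝ} (hs : 0 < s) (c t : ℝ) :
    pdf s (c - t) = ProbabilityTheory.gaussianPDFReal c s.toNNReal t := by
  rw [pdf, ProbabilityTheory.gaussianPDFReal, Real.coe_toNNReal s hs.le, ← neg_sub t c, neg_sq]

lemma continuous_pdf (s : ℝ) : Continuous (pdf s) := by
  unfold pdf
  fun_prop

lemma pdf_nonneg (s t : ℝ) : 0 ≤ pdf s t := by
  unfold pdf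
  positivity

lemma norm_pdf_le {s : ℝ} (hs : 0 < s) (t : ℝ) : ‖pdf s t‖ ≤ (√(2 * π * s))⁻¹ := by
  rw [Real.norm_of_nonneg (pdf_nonneg s t)]
  refine mul_le_of_le_one_right (by positivity) (Real.exp_le_one_iff.2 ?_)
  exact div_nonpos_of_nonpos_of_nonneg (neg_nonpos.2 (sq_nonneg t)) (by positivity)

lemma integrable_pdf_sub {s : ℝ} (hs : 0 < s) (c : ℝ) : Integrable fun t => pdf s (c - t) := by
  simpa only [pdf_eq_gaussianPDFReal hs] using
    ProbabilityTheory.integrable_gaussianPDFReal c s.toNNReal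

lemma integral_pdf_sub {s : ℝ} (hs : 0 < s) (c : ℝ) : ∫ t, pdf s (c - t) = 1 := by
  simpa only [pdf_eq_gaussianPDFReal hs] using
    ProbabilityTheory.integral_gaussianPDFReal_eq_one c (Real.toNNReal_pos.2 hs).ne'

lemma pdf_eq_stdphi {s : ℝ} (hs : 0 < s) (t : ℝ) : pdf s t = 1 / √s * stdphi (t / √s) := by
  have h : -(t / √s) ^ 2 / 2 = -t ^ 2 / (2 * s) := by
    rw [div_pow, Real.sq_sqrt hs.le]
    field_simp
  rw [pdf, stdphi, h, Real.sqrt_mul (by positivity)]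
  field_simp

/-- Completing the square in a product of two Gaussian densities. -/
lemma pdf_mul_pdf {s u : ℝ} (hs : 0 < s) (hu : 0 < u) (b c t : ℝ) :
    pdf u (b - t) * pdf s (c - t) =
      pdf (s + u) (b - c) * pdf (s * u / (s + u)) ((b * s + c * u) / (s + u) - t) := by
  have h : √(2 * π * u) * √(2 * π * s) = √(2 * π * (s + u)) * √(2 * π * (s * u / (s + u))) := by
    rw [← Real.sqrt_mul (by positivity), ← Real.sqrt_mul (by positivity)]
    congr 1
    field_simp
  unfold pdf
  rw [mul_mul_mul_comm, mul_mul_mul_comm (√(2 * π * (s + u)))⁻¹, ← mul_inv, ← mul_inv, h,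
    ← Real.exp_add, ← Real.exp_add]
  congr 2
  field_simp
  ring

lemma integral_pdf_mul_pdf {s u : ℝ} (hs : 0 < s) (hu : 0 < u) (b c : ℝ) :
    ∫ t, pdf u (b - t) * pdf s (c - t) = pdf (s + u) (b - c) := by
  simp_rw [pdf_mul_pdf hs hu]
  rw [integral_const_mul, integral_pdf_sub (by positivity), mul_one]

/-- The density at `c - t` of the mixture, over `v ∼ L`, of the normal laws `N(v * r, s)`. -/
noncomputable def mixture (L : Measure ℝ) (s r c t : ℝ) : ℝ := ∫ v, pdf s (c - t - v * r) ∂L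

variable {s u : ℝ} (L M : Measure ℝ) [IsProbabilityMeasure L] [IsProbabilityMeasure M]

lemma integrable_prod_pdf (hs : 0 < s) (r c : ℝ) :
    Integrable (fun z : ℝ × ℝ => pdf s (c - z.1 - z.2 * r)) (volume.prod L) := by
  have h (v t : ℝ) : c - t - v * r = c - v * r - t := by ring
  have hm : Continuous fun z : ℝ × ℝ => pdf s (c - z.1 - z.2 * r) :=
    (continuous_pdf s).comp (by fun_prop)
  rw [integrable_prod_iff' hm.aestronglyMeasurable]
  refine ⟨.of_forall fun v => ?_, ?_⟩
  · simpa only [h] using integrable_pdf_sub hs (c - v * r)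
  · simp only [Real.norm_of_nonneg (pdf_nonneg _ _), h, integral_pdf_sub hs, integrable_const]

lemma integral_mixture (hs : 0 < s) (r c : ℝ) : ∫ t, mixture L s r c t = 1 := by
  have h (v t : ℝ) : c - t - v * r = c - v * r - t := by ring
  unfold mixture
  rw [integral_integral_swap (integrable_prod_pdf L hs r c)]
  simp only [h, integral_pdf_sub hs, integral_const, probReal_univ, smul_eq_mul,
    mul_one]

lemma stronglyMeasurable_mixture (r c : ℝ) : StronglyMeasurable (mixture L s r c) :=
  StronglyMeasurable.integral_prod_right (f := fun t v => pdf s (c - t - v * r))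
    ((continuous_pdf s).comp (by fun_prop)).stronglyMeasurable

lemma norm_mixture_le (hs : 0 < s) (r c t : ℝ) : ‖mixture L s r c t‖ ≤ (√(2 * π * s))⁻¹ := by
  simpa [mixture] using norm_integral_le_of_norm_le_const (μ := L)
    (.of_forall fun v => norm_pdf_le hs (c - t - v * r))

lemma integral_mixture_mul_mixture (hs : 0 < s) (hu : 0 < u) (r b c : ℝ) :
    ∫ t, mixture M u r b t * mixture L s r c t =
      ∫ v, ∫ w, pdf (s + u) (b - c - (w - v) * r) ∂M ∂L := by
  have hswap : ∫ t, mixture M u r b t * mixture L s r c t =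
      ∫ v, (∫ t, mixture M u r b t * pdf s (c - t - v * r)) ∂L := by
    simp_rw [mixture.eq_def L, ← integral_const_mul]
    have hint : Integrable (fun z : ℝ × ℝ => mixture M u r b z.1 * pdf s (c - z.1 - z.2 * r))
        (volume.prod L) :=
      (integrable_prod_pdf L hs r c).bdd_mul
        ((stronglyMeasurable_mixture M r b).comp_measurable measurable_fst).aestronglyMeasurable
        (.of_forall fun z => norm_mixture_le M hu r b z.1)
    exact integral_integral_swap hint
  rw [hswap]
  congr 1 with v
  simp_rw [mixture, ← integral_mul_const]
  rw [integral_integral_swap]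
  · congr 1 with w
    have h (e v t : ℝ) : e - t - v * r = e - v * r - t := by ring
    simp only [h, integral_pdf_mul_pdf hs hu]
    ring_nf
  · refine (integrable_prod_pdf M hu r b).mul_bdd (c := (√(2 * π * s))⁻¹) ?_
      (.of_forall fun z => norm_pdf_le hs _)
    exact ((continuous_pdf s).comp (by fun_prop)).aestronglyMeasurable

end CenteredGaussian

lemma mvn_smul_one (d : ℕ) {s : ℝ} (hs : 0 < s) (z : Fin d → ℝ) :
    mvn d (s • 1) z = (2 * π * s) ^ (-(d : ℝ) / 2) * Real.exp (-(z ⬝ᵥ z) / (2 * s)) := by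
  have hinv : (s • (1 : Matrix (Fin d) (Fin d) ℝ))⁻¹ = s⁻¹ • 1 := by
    refine Matrix.inv_eq_right_inv ?_
    rw [smul_mul_smul_comm, mul_inv_cancel₀ hs.ne', one_smul, one_mul]
  rw [mvn, hinv, Matrix.det_smul, Matrix.det_one, mul_one, Fintype.card_fin,
    Matrix.smul_mulVec, Matrix.one_mulVec, dotProduct_smul, smul_eq_mul, ← Real.rpow_natCast,
    ← Real.rpow_mul hs.le, Real.mul_rpow (by positivity) hs.le]
  congr 2
  · ring_nf
  · field_simp

lemma mvn_succ_smul_one (n : ℕ) {s : ℝ} (hs : 0 < s) (z : Fin (n + 1) → ℝ) :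
    mvn (n + 1) (s • 1) z = CenteredGaussian.pdf s (z 0) * mvn n (s • 1) (z ∘ Fin.succ) := by
  have hc : (2 * π * s) ^ (-((n + 1 : ℕ) : ℝ) / 2) =
      (√(2 * π * s))⁻¹ * (2 * π * s) ^ (-(n : ℝ) / 2) := by
    rw [Real.sqrt_eq_rpow, ← Real.rpow_neg (by positivity), ← Real.rpow_add (by positivity)]
    push_cast
    ring_nf
  have hz : z ⬝ᵥ z = z 0 ^ 2 + (z ∘ Fin.succ) ⬝ᵥ (z ∘ Fin.succ) := by
    simp [dotProduct, Fin.sum_univ_succ, sq]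
  rw [mvn_smul_one _ hs, mvn_smul_one _ hs, CenteredGaussian.pdf, mul_mul_mul_comm, ← Real.exp_add,
    hc, hz]
  ring_nf

lemma mvn_smul_one_mulVec (d : ℕ) {s : ℝ} (hs : 0 < s) {H : Matrix (Fin d) (Fin d) ℝ}
    (hH : H * Hᵀ = 1) (z : Fin d → ℝ) : mvn d (s • 1) (H *ᵥ z) = mvn d (s • 1) z := by
  rw [mvn_smul_one _ hs, mvn_smul_one _ hs, dotProduct_mulVec, ← mulVec_transpose, mulVec_mulVec,
    mul_eq_one_comm.1 hH, one_mulVec]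

lemma measurePreserving_mulVec {ι : Type*} [Fintype ι] [DecidableEq ι] {H : Matrix ι ι ℝ}
    (hH : H * Hᵀ = 1) : MeasurePreserving (H *ᵥ ·) := by
  have hdet : H.det * H.det = 1 := by simpa using congrArg Matrix.det hH
  have habs : |H.det| = 1 := by
    rcases mul_self_eq_one_iff.1 hdet with h | h <;> simp [h]
  refine ⟨(Continuous.matrix_mulVec continuous_const continuous_id).measurable, ?_⟩
  have h := Real.map_matrix_volume_pi_eq_smul_volume_pi (M := H) (left_ne_zero_of_mul_eq_one hdet)
  rw [abs_inv, habs, inv_one, ENNReal.ofReal_one, one_smul] at h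
  exact h

/-- In orthogonal coordinates, a product of a function of the first coordinate and a function of
the remaining ones integrates to the product of the integrals. -/
lemma integral_mulVec_zero_mul_mulVec_succ (n : ℕ) {H : Matrix (Fin (n + 1)) (Fin (n + 1)) ℝ}
    (hH : H * Hᵀ = 1) (f : ℝ → ℝ) (g : (Fin n → ℝ) → ℝ) :
    ∫ θ, f ((H *ᵥ θ) 0) * g ((H *ᵥ θ) ∘ Fin.succ) = (∫ t, f t) * ∫ ζ, g ζ := by
  have hemb : MeasurableEmbedding (H *ᵥ ·) :=
    (Continuous.matrix_mulVec continuous_const continuous_id).measurableEmbedding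
      (Matrix.mulVec_injective_of_isUnit (IsUnit.of_mul_eq_one _ hH))
  have hsplit := (volume_preserving_piFinSuccAbove (fun _ : Fin (n + 1) => ℝ) 0).integral_comp'
    (fun z => f z.1 * g z.2)
  rw [(measurePreserving_mulVec hH).integral_comp hemb
    (fun z => f (z 0) * g (z ∘ Fin.succ)), ← integral_prod_mul f g]
  exact hsplit

/-- factorization of the Bayes predictive density for the MMN model under a
prior of the form `π(θ) = π₀(H₂θ)` (uniform along the direction `a`):
`q̂_π(y; x) = q̂_U¹(h₁ᵀy; h₁ᵀx) · q̂'_{π₀}(H₂y; H₂x)` (here `d = n + 1 ≥ 2`). -/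
theorem bayes_predictive_factorization
    (n : ℕ) (hd : 2 ≤ n + 1) (a : Fin (n + 1) → ℝ) (ha : a ≠ 0)
    (sX2 sY2 sS2 : ℝ) (hX : 0 < sX2) (hY : 0 < sY2) (hS : sS2 = sX2 + sY2)
    (L₁ L₂ : Measure ℝ) [IsProbabilityMeasure L₁] [IsProbabilityMeasure L₂]
    (p q : (Fin (n + 1) → ℝ) → (Fin (n + 1) → ℝ) → ℝ)
    (hp : p = fun x θ => ∫ v₁,
        mvn (n + 1) (sX2 • (1 : Matrix (Fin (n + 1)) (Fin (n + 1)) ℝ)) (x - θ - v₁ • a) ∂L₁)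
    (hq : q = fun y θ => ∫ v₂,
        mvn (n + 1) (sY2 • (1 : Matrix (Fin (n + 1)) (Fin (n + 1)) ℝ)) (y - θ - v₂ • a) ∂L₂)
    (H : Matrix (Fin (n + 1)) (Fin (n + 1)) ℝ) (hH : H * Hᵀ = 1)
    (hrow : ∀ j, H 0 j = a j / Real.sqrt (a ⬝ᵥ a))
    (H₂ : Matrix (Fin n) (Fin (n + 1)) ℝ) (hH₂ : ∀ i j, H₂ i j = H i.succ j)
    (π₀ : (Fin n → ℝ) → ℝ) (hπ₀meas : Measurable π₀) (hπ₀pos : ∀ ζ, 0 ≤ π₀ ζ)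
    (hmarg : ∀ z : Fin n → ℝ,
        Integrable (fun ζ : Fin n → ℝ =>
          mvn n (sX2 • (1 : Matrix (Fin n) (Fin n) ℝ)) (z - ζ) * π₀ ζ))
    (hmargpos : ∀ z : Fin n → ℝ,
        0 < ∫ ζ : Fin n → ℝ, mvn n (sX2 • (1 : Matrix (Fin n) (Fin n) ℝ)) (z - ζ) * π₀ ζ)
    (qπ : (Fin (n + 1) → ℝ) → (Fin (n + 1) → ℝ) → ℝ)
    (hqπ : qπ = fun y x =>
        (∫ θ : Fin (n + 1) → ℝ, q y θ * p x θ * π₀ (H₂ *ᵥ θ)) /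
          (∫ θ : Fin (n + 1) → ℝ, p x θ * π₀ (H₂ *ᵥ θ)))
    (qU1 : ℝ → ℝ → ℝ)
    (hqU1 : qU1 = fun t s => ∫ v₁, ∫ v₂,
        (1 / Real.sqrt sS2) *
          stdphi ((t - s - (v₂ - v₁) * Real.sqrt (a ⬝ᵥ a)) / Real.sqrt sS2) ∂L₂ ∂L₁)
    (qπ₀' : (Fin n → ℝ) → (Fin n → ℝ) → ℝ)
    (hqπ₀' : qπ₀' = fun w z =>
        (∫ ζ : Fin n → ℝ, mvn n (sY2 • (1 : Matrix (Fin n) (Fin n) ℝ)) (w - ζ) *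
            mvn n (sX2 • (1 : Matrix (Fin n) (Fin n) ℝ)) (z - ζ) * π₀ ζ) /
          (∫ ζ : Fin n → ℝ, mvn n (sX2 • (1 : Matrix (Fin n) (Fin n) ℝ)) (z - ζ) * π₀ ζ)) :
    ∀ x y : Fin (n + 1) → ℝ,
      qπ y x = qU1 (H 0 ⬝ᵥ y) (H 0 ⬝ᵥ x) * qπ₀' (H₂ *ᵥ y) (H₂ *ᵥ x) := by
  have ha_pos : 0 < a ⬝ᵥ a := by simpa using Matrix.dotProduct_star_self_pos_iff.2 ha
  set r := √(a ⬝ᵥ a)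
  have hr_pos : 0 < r := Real.sqrt_pos.2 ha_pos
  have ha_row : a = r • H 0 := by
    ext j
    rw [Pi.smul_apply, smul_eq_mul, hrow, mul_div_cancel₀ _ hr_pos.ne']
  have hrows (i : Fin (n + 1)) : H i ⬝ᵥ H 0 = (1 : Matrix (Fin (n + 1)) (Fin (n + 1)) ℝ) i 0 := by
    rw [← hH]
    rfl
  have hHa0 : H 0 ⬝ᵥ a = r := by
    rw [ha_row, dotProduct_smul, hrows]
    simp
  have hH₂a : H₂ *ᵥ a = 0 := by
    ext i
    have hi : H₂ i = H i.succ := funext (hH₂ i)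
    change H₂ i ⬝ᵥ a = 0
    rw [hi, ha_row, dotProduct_smul, hrows]
    simp
  have hsucc (z : Fin (n + 1) → ℝ) : (H *ᵥ z) ∘ Fin.succ = H₂ *ᵥ z := by
    ext i
    simp [mulVec, dotProduct, hH₂]
  have hmvn {s : ℝ} (hs : 0 < s) (x θ : Fin (n + 1) → ℝ) (v : ℝ) :
      mvn (n + 1) (s • 1) (x - θ - v • a) =
        CenteredGaussian.pdf s (H 0 ⬝ᵥ x - (H *ᵥ θ) 0 - v * r) *
          mvn n (s • 1) (H₂ *ᵥ x - (H *ᵥ θ) ∘ Fin.succ) := by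
    have h0 : (H *ᵥ (x - θ - v • a)) 0 = H 0 ⬝ᵥ x - (H *ᵥ θ) 0 - v * r := by
      change H 0 ⬝ᵥ (x - θ - v • a) = H 0 ⬝ᵥ x - H 0 ⬝ᵥ θ - v * r
      rw [dotProduct_sub, dotProduct_sub, dotProduct_smul, hHa0, smul_eq_mul]
    rw [← mvn_smul_one_mulVec _ hs hH, mvn_succ_smul_one _ hs, h0, hsucc, hsucc, mulVec_sub,
      mulVec_sub, mulVec_smul, hH₂a, smul_zero, sub_zero]
  have hmodel {s : ℝ} (hs : 0 < s) (L : Measure ℝ) (x θ : Fin (n + 1) → ℝ) :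
      ∫ v, mvn (n + 1) (s • 1) (x - θ - v • a) ∂L =
        CenteredGaussian.mixture L s r (H 0 ⬝ᵥ x) ((H *ᵥ θ) 0) *
          mvn n (s • 1) (H₂ *ᵥ x - (H *ᵥ θ) ∘ Fin.succ) := by
    simp_rw [hmvn hs, integral_mul_const, CenteredGaussian.mixture]
  intro x y
  have hden : ∫ θ, p x θ * π₀ (H₂ *ᵥ θ) =
      ∫ ζ, mvn n (sX2 • 1) (H₂ *ᵥ x - ζ) * π₀ ζ := by
    have h := integral_mulVec_zero_mul_mulVec_succ n hH
      (CenteredGaussian.mixture L₁ sX2 r (H 0 ⬝ᵥ x))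
      (fun ζ => mvn n (sX2 • 1) (H₂ *ᵥ x - ζ) * π₀ ζ)
    rw [CenteredGaussian.integral_mixture L₁ hX, one_mul] at h
    rw [← h, hp]
    simp_rw [hmodel hX, ← hsucc, mul_assoc]
  have hnum : ∫ θ, q y θ * p x θ * π₀ (H₂ *ᵥ θ) = qU1 (H 0 ⬝ᵥ y) (H 0 ⬝ᵥ x) *
      ∫ ζ, mvn n (sY2 • 1) (H₂ *ᵥ y - ζ) * mvn n (sX2 • 1) (H₂ *ᵥ x - ζ) * π₀ ζ := by
    have h := integral_mulVec_zero_mul_mulVec_succ n hH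
      (fun t => CenteredGaussian.mixture L₂ sY2 r (H 0 ⬝ᵥ y) t *
        CenteredGaussian.mixture L₁ sX2 r (H 0 ⬝ᵥ x) t)
      (fun ζ => mvn n (sY2 • 1) (H₂ *ᵥ y - ζ) * mvn n (sX2 • 1) (H₂ *ᵥ x - ζ) * π₀ ζ)
    rw [CenteredGaussian.integral_mixture_mul_mixture L₁ L₂ hX hY] at h
    simp_rw [CenteredGaussian.pdf_eq_stdphi (add_pos hX hY), ← hS] at h
    rw [hqU1, ← h, hp, hq]
    simp_rw [hmodel hX, hmodel hY, ← hsucc]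
    congr 1 with θ
    ring
  simp only [hqπ, hqπ₀', hnum, hden, mul_div_assoc]
end

section
/- For all B, c ∈ ℝ and A > 0: ∫₀^∞ Φ(c t) · exp(−t²/(2A) + B t) dt = e^{AB²/2} · √(2πA) · Φ₂( cAB/√(1 + c²A), B√A ; c√A/√(1 + c²A) ). -/
open MeasureTheory Real

/-- The cdf at `(z₁, z₂)` of the centered bivariate normal distribution with unit
variances and correlation `ρ`. -/
noncomputable def Phi2 (z₁ z₂ ρ : ℝ) : ℝ :=
  ∫ s in Set.Iic z₁, ∫ t in Set.Iic z₂,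
    Real.exp (-(s ^ 2 - 2 * ρ * s * t + t ^ 2) / (2 * (1 - ρ ^ 2)))
      / (2 * π * Real.sqrt (1 - ρ ^ 2))

/-- Increasing affine change of variables on a left half-line. -/
theorem integral_Iic_comp_affine (f : ℝ → ℝ) {D : ℝ} (hD : 0 < D) (k z : ℝ) :
    ∫ s in Set.Iic z, D * f (D * s - k) = ∫ u in Set.Iic (D * z - k), f u := by
  rw [← integral_indicator measurableSet_Iic, ← integral_indicator measurableSet_Iic]
  have h := Measure.integral_comp_mul_left
    (fun u => (Set.Iic (D * z - k)).indicator f (u - k)) D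
  rw [abs_of_pos (inv_pos.2 hD), smul_eq_mul, eq_inv_mul_iff_mul_eq₀ hD.ne',
    ← integral_const_mul, integral_sub_right_eq_self _ k] at h
  rw [← h]
  congr 1
  ext s
  have hs : s ∈ Set.Iic z ↔ D * s - k ∈ Set.Iic (D * z - k) := by
    simp [hD]
  by_cases hz : s ∈ Set.Iic z
  · rw [Set.indicator_of_mem hz, Set.indicator_of_mem (hs.1 hz)]
  · rw [Set.indicator_of_notMem hz, Set.indicator_of_notMem (mt hs.2 hz), mul_zero]

/-- Decreasing affine change of variables from a left half-line to the positive half-line. -/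
theorem integral_Ioi_comp_sub_div (f : ℝ → ℝ) {a : ℝ} (ha : 0 < a) (z : ℝ) :
    ∫ x in Set.Ioi (0 : ℝ), f (z - x / a) = a * ∫ t in Set.Iic z, f t := by
  rw [← integral_Ici_eq_integral_Ioi, ← integral_indicator measurableSet_Ici,
    ← integral_indicator measurableSet_Iic]
  have h := Measure.integral_comp_div
    (fun u => (Set.Iic z).indicator f (z - u)) a
  rw [abs_of_pos ha, smul_eq_mul, integral_sub_left_eq_self _ volume z] at h
  rw [← h]
  congr 1
  ext x
  have hx : x ∈ Set.Ici (0 : ℝ) ↔ z - x / a ∈ Set.Iic z := by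
    simp [le_div_iff₀ ha]
  by_cases hz : x ∈ Set.Ici (0 : ℝ)
  · rw [Set.indicator_of_mem hz, Set.indicator_of_mem (hx.1 hz)]
  · rw [Set.indicator_of_notMem hz, Set.indicator_of_notMem (mt hx.2 hz)]

theorem integrable_exp_neg_sheared_sq {D k : ℝ} (hD : 0 < D) (hDk : D ^ 2 = 1 + k ^ 2) :
    Integrable (fun p : ℝ × ℝ => D * stdphi (D * p.1 - k * p.2) * stdphi p.2)
      (volume.prod volume) := by
  have hk : |k| < D := abs_lt_of_sq_lt_sq (by linarith) hD.le
  set b := D * (D - |k|) / 2 with hb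
  have hb0 : 0 < b := by
    have := sub_pos.2 hk
    positivity
  have h1 : Integrable (fun x : ℝ => Real.exp (-b * x ^ 2)) := integrable_exp_neg_mul_sq hb0
  refine ((h1.mul_prod h1).const_mul (D / (2 * π))).mono' ?_ (.of_forall fun p => ?_)
  · unfold stdphi
    fun_prop
  · have hsq : Real.sqrt (2 * π) * Real.sqrt (2 * π) = 2 * π :=
      Real.mul_self_sqrt (by positivity)
    have heq : D * stdphi (D * p.1 - k * p.2) * stdphi p.2
        = D / (2 * π) * Real.exp (-((D * p.1 - k * p.2) ^ 2) / 2 + -(p.2 ^ 2) / 2) := by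
      rw [Real.exp_add, ← hsq]
      unfold stdphi
      ring
    rw [heq, Real.norm_of_nonneg (by positivity), ← Real.exp_add]
    refine mul_le_mul_of_nonneg_left (Real.exp_le_exp.2 ?_) (by positivity)
    have hc : k * p.1 * p.2 ≤ |k| * (p.1 ^ 2 + p.2 ^ 2) / 2 := by
      rcases abs_cases k with ⟨h, h'⟩ | ⟨h, h'⟩ <;> rw [h]
      · nlinarith [mul_nonneg h' (sq_nonneg (p.1 - p.2))]
      · nlinarith [mul_nonneg (neg_pos.2 h').le (sq_nonneg (p.1 + p.2))]
    have hc' := mul_le_mul_of_nonneg_left hc hD.le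
    have : k ^ 2 = D ^ 2 - 1 := by linarith
    have e : -((D * p.1 - k * p.2) ^ 2) / 2 + -(p.2 ^ 2) / 2
        = -(D ^ 2 * (p.1 ^ 2 + p.2 ^ 2) / 2) + D * (k * p.1 * p.2) := by
      linear_combination (-p.2 ^ 2 / 2) * this
    rw [e, hb]
    linarith

/-- Conditioning on the second coordinate, the bivariate normal cdf with correlation `k / D`,
`D ^ 2 = 1 + k ^ 2`, is a single integral of the normal cdf. -/
theorem Phi2_div_eq_integral {D k : ℝ} (hD : 0 < D) (hDk : D ^ 2 = 1 + k ^ 2) (z₁ z₂ : ℝ) :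
    Phi2 z₁ z₂ (k / D) = ∫ t in Set.Iic z₂, stdPhi (D * z₁ - k * t) * stdphi t := by
  have hρ : 1 - (k / D) ^ 2 = (D ^ 2)⁻¹ := by
    field_simp
    linarith
  have hsqrt : Real.sqrt (1 - (k / D) ^ 2) = D⁻¹ := by
    rw [hρ, Real.sqrt_inv, Real.sqrt_sq hD.le]
  have hsq : Real.sqrt (2 * π) * Real.sqrt (2 * π) = 2 * π :=
    Real.mul_self_sqrt (by positivity)
  have hker (s t : ℝ) :
      Real.exp (-(s ^ 2 - 2 * (k / D) * s * t + t ^ 2) / (2 * (1 - (k / D) ^ 2)))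
        / (2 * π * Real.sqrt (1 - (k / D) ^ 2))
      = D * stdphi (D * s - k * t) * stdphi t := by
    have e : -(s ^ 2 - 2 * (k / D) * s * t + t ^ 2) / (2 * (D ^ 2)⁻¹)
        = -((D * s - k * t) ^ 2) / 2 + -(t ^ 2) / 2 := by
      field_simp
      linear_combination (-t ^ 2) * hDk
    rw [hsqrt, hρ, e, Real.exp_add, ← hsq]
    unfold stdphi
    field_simp
  unfold Phi2
  simp_rw [hker]
  rw [integral_integral_swap]
  · congr 1
    ext t
    rw [integral_mul_const, integral_Iic_comp_affine stdphi hD (k * t) z₁, stdPhi]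
  · exact (integrable_exp_neg_sheared_sq hD hDk).mono_measure
      (Measure.prod_mono Measure.restrict_le_self Measure.restrict_le_self)

/-- `∫₀^∞ Φ(c t) e^{−t²/(2A) + Bt} dt
  = e^{AB²/2} √(2πA) Φ₂(cAB/√(1 + c²A), B√A; c√A/√(1 + c²A))`. -/
theorem integral_Phi_exp_eq_Phi2 (B c : ℝ) (A : ℝ) (hA : 0 < A) :
    ∫ t in Set.Ioi (0 : ℝ), stdPhi (c * t) * Real.exp (-t ^ 2 / (2 * A) + B * t)
      = Real.exp (A * B ^ 2 / 2) * Real.sqrt (2 * π * A) *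
          Phi2 (c * A * B / Real.sqrt (1 + c ^ 2 * A)) (B * Real.sqrt A)
            (c * Real.sqrt A / Real.sqrt (1 + c ^ 2 * A)) := by
  set a := Real.sqrt A with ha
  set D := Real.sqrt (1 + c ^ 2 * A) with hDdef
  have ha0 : 0 < a := Real.sqrt_pos.2 hA
  have hD0 : 0 < D := Real.sqrt_pos.2 (by positivity)
  have haA : A = a ^ 2 := (Real.sq_sqrt hA.le).symm
  have hDk : D ^ 2 = 1 + (c * a) ^ 2 := by
    rw [hDdef, Real.sq_sqrt (by positivity), mul_pow, ← haA]
  have hs : Real.sqrt (2 * π * A) = Real.sqrt (2 * π) * a := Real.sqrt_mul (by positivity) A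
  rw [Phi2_div_eq_integral hD0 hDk, hs, mul_assoc, mul_assoc, ← integral_Ioi_comp_sub_div _ ha0,
    ← integral_const_mul, ← integral_const_mul]
  congr 1
  ext x
  have harg : D * (c * A * B / D) - c * a * (B * a - x / a) = c * x := by
    rw [haA]
    field_simp
    ring
  have hexp : -x ^ 2 / (2 * A) + B * x = A * B ^ 2 / 2 + -((B * a - x / a) ^ 2) / 2 := by
    rw [haA]
    field_simp
    ring
  rw [harg, hexp, Real.exp_add, stdphi]
  field_simp
end
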